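/- Suppose a non-elementary group G acts geometrically (properly and cocompactly) by isometries on a proper geodesic metric space (X,d) that is a Morse local-to-global space and contains a Morse geodesic ray, and let H < G be a stable subgroup of infinite index. Then there exist a Morse element g ∈ G, a constant C ≥ 0, and a subset H' ⊆ H such that: every h ∈ H satisfies d_G(h,h') ≤ C for some h' ∈ H'; ω(H') = ω(H); and the evaluation map ι : 𝕎(H', {g}) → G on alternating words is injective. -/

import Mathlib

open Metric Set Filter Pointwise

/-- `γ` restricted to `[0, L]` is a `(lam, c)`-quasi-geodesic parametrized by arc length:
the length of the subpath from `s` to `t` is `t - s`. -/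
def IsQuasiGeodesicOn {X : Type*} [MetricSpace X] (γ : ℝ → X) (L lam c : ℝ) : Prop :=
  (∀ s t : ℝ, 0 ≤ s → s ≤ t → t ≤ L → dist (γ s) (γ t) ≤ t - s) ∧
  (∀ s t : ℝ, 0 ≤ s → s ≤ t → t ≤ L → t - s ≤ lam * dist (γ s) (γ t) + c)

/-- `γ` restricted to `[0, L]` is a geodesic (unit speed). -/
def IsGeodesicOn {X : Type*} [MetricSpace X] (γ : ℝ → X) (L : ℝ) : Prop :=
  ∀ s t : ℝ, s ∈ Set.Icc 0 L → t ∈ Set.Icc 0 L → dist (γ s) (γ t) = |s - t|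

/-- A metric space is geodesic if any two points are joined by a geodesic. -/
def GeodesicSpace (X : Type*) [MetricSpace X] : Prop :=
  ∀ x y : X, ∃ γ : ℝ → X, γ 0 = x ∧ γ (dist x y) = y ∧ IsGeodesicOn γ (dist x y)

/-- The path `γ` on `[0, L]` is `M`-Morse: every `(lam, c)`-quasi-geodesic with endpoints
on `γ` stays within distance `M lam c` of the corresponding subpath of `γ`. -/
def IsMorseOn {X : Type*} [MetricSpace X] (γ : ℝ → X) (L : ℝ) (M : ℝ → ℝ → ℝ) : Prop :=
  ∀ lam c : ℝ, 1 ≤ lam → 0 ≤ c →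
    ∀ (β : ℝ → X) (Lβ : ℝ), 0 ≤ Lβ → IsQuasiGeodesicOn β Lβ lam c →
      ∀ s t : ℝ, 0 ≤ s → s ≤ t → t ≤ L → β 0 = γ s → β Lβ = γ t →
        ∀ u ∈ Set.Icc (0:ℝ) Lβ, ∃ v ∈ Set.Icc s t, dist (β u) (γ v) ≤ M lam c

/-- `γ` on `[0, Lγ]` is an `(L; M; lam, c)`-local Morse quasi-geodesic: every subpath of
length at most `L` is an `(M; lam, c)`-Morse quasi-geodesic. -/
def LocalMorseQuasiGeodesicOn {X : Type*} [MetricSpace X] (γ : ℝ → X) (Lγ L : ℝ)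
    (M : ℝ → ℝ → ℝ) (lam c : ℝ) : Prop :=
  ∀ s t : ℝ, 0 ≤ s → s ≤ t → t ≤ Lγ → t - s ≤ L →
    IsQuasiGeodesicOn (fun u => γ (s + u)) (t - s) lam c ∧
    IsMorseOn (fun u => γ (s + u)) (t - s) M

/-- Morse local-to-global space. -/
def MorseLocalToGlobalSpace (X : Type*) [MetricSpace X] : Prop :=
  ∀ (M : ℝ → ℝ → ℝ) (lam c : ℝ), 1 ≤ lam → 0 ≤ c →
    ∃ (M' : ℝ → ℝ → ℝ) (L lam' c' : ℝ), 0 ≤ L ∧ 1 ≤ lam' ∧ 0 ≤ c' ∧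
      ∀ (γ : ℝ → X) (Lγ : ℝ), 0 ≤ Lγ → LocalMorseQuasiGeodesicOn γ Lγ L M lam c →
        IsQuasiGeodesicOn γ Lγ lam' c' ∧ IsMorseOn γ Lγ M'

/-- A Morse geodesic ray: an isometric embedding of `[0, ∞)` which is `M`-Morse. -/
def IsMorseGeodesicRay {X : Type*} [MetricSpace X] (γ : ℝ → X) (M : ℝ → ℝ → ℝ) : Prop :=
  (∀ s t : ℝ, 0 ≤ s → 0 ≤ t → dist (γ s) (γ t) = |s - t|) ∧
  (∀ lam c : ℝ, 1 ≤ lam → 0 ≤ c →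
    ∀ (β : ℝ → X) (Lβ : ℝ), 0 ≤ Lβ → IsQuasiGeodesicOn β Lβ lam c →
      ∀ s t : ℝ, 0 ≤ s → s ≤ t → β 0 = γ s → β Lβ = γ t →
        ∀ u ∈ Set.Icc (0:ℝ) Lβ, ∃ v ∈ Set.Icc s t, dist (β u) (γ v) ≤ M lam c)

/-- The action of `G` on `X` is by isometries. -/
def IsometricAction (G X : Type*) [Group G] [MetricSpace X] [MulAction G X] : Prop :=
  ∀ (g : G) (x y : X), dist (g • x) (g • y) = dist x y

/-- The action of `G` on `X` is (metrically) proper. -/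
def ProperAction (G X : Type*) [Group G] [MetricSpace X] [MulAction G X] : Prop :=
  ∀ (x : X) (r : ℝ), 0 < r → {g : G | dist x (g • x) ≤ r}.Finite

/-- The action of `G` on `X` is cocompact. -/
def CocompactAction (G X : Type*) [Group G] [MetricSpace X] [MulAction G X] : Prop :=
  ∃ K : Set X, IsCompact K ∧ ∀ x : X, ∃ g : G, g • x ∈ K

/-- `H` is a stable subgroup: there are a Morse gauge `M` and `D ≥ 0` such that every
geodesic `[o, h • o]` is `M`-Morse and contained in the `D`-neighborhood of `H • o`. -/
def IsStableSubgroup {X G : Type*} [MetricSpace X] [Group G] [MulAction G X]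
    (o : X) (H : Subgroup G) : Prop :=
  ∃ (M : ℝ → ℝ → ℝ) (D : ℝ), 0 ≤ D ∧
    ∀ h ∈ H, ∀ γ : ℝ → X, γ 0 = o → γ (dist o (h • o)) = h • o →
      IsGeodesicOn γ (dist o (h • o)) →
      IsMorseOn γ (dist o (h • o)) M ∧
      ∀ s ∈ Set.Icc 0 (dist o (h • o)), ∃ h' ∈ H, dist (γ s) (h' • o) ≤ D

/-- A Morse element: an infinite order element generating a stable cyclic subgroup. -/
def IsMorseElement {X G : Type*} [MetricSpace X] [Group G] [MulAction G X]
    (o : X) (g : G) : Prop :=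
  ¬ IsOfFinOrder g ∧ IsStableSubgroup o (Subgroup.zpowers g)

/-- `H` is quasi-convex: geodesics with endpoints on `H • o` stay in a `σ`-neighborhood
of `H • o`. -/
def IsQuasiConvexSubgroup {X G : Type*} [MetricSpace X] [Group G] [MulAction G X]
    (o : X) (H : Subgroup G) : Prop :=
  ∃ σ : ℝ, 0 ≤ σ ∧ ∀ h h' : G, h ∈ H → h' ∈ H →
    ∀ γ : ℝ → X, γ 0 = h • o → γ (dist (h • o) (h' • o)) = h' • o →
      IsGeodesicOn γ (dist (h • o) (h' • o)) →
      ∀ s ∈ Set.Icc 0 (dist (h • o) (h' • o)), ∃ h'' ∈ H, dist (γ s) (h'' • o) ≤ σ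

/-- The growth rate `ω(A) = limsup (log #(B(n) ∩ A)) / n` of a subset `A ⊆ G`. -/
noncomputable def growthRate {X G : Type*} [MetricSpace X] [Group G] [MulAction G X]
    (o : X) (A : Set G) : ℝ :=
  Filter.limsup (fun n : ℕ =>
    Real.log ((A ∩ {g : G | dist o (g • o) ≤ (n : ℝ)}).ncard) / (n : ℝ)) Filter.atTop

/-- Convergence of the Poincaré series `𝒫_A(s) = Σ_{g ∈ A} exp (-s · d_G(1, g))`. -/
def PoincareSummable {X G : Type*} [MetricSpace X] [Group G] [MulAction G X]
    (o : X) (A : Set G) (s : ℝ) : Prop :=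
  Summable fun g : A => Real.exp (-s * dist o ((g : G) • o))

/-- A group is virtually cyclic if it has a cyclic subgroup of finite index. -/
def VirtuallyCyclic (G : Type*) [Group G] : Prop :=
  ∃ H : Subgroup G, IsCyclic H ∧ H.FiniteIndex

/-- The annulus set `𝒜(n, Δ) = {h ∈ H : |d_G(1,h) - n| ≤ Δ}`. -/
def annulus {X G : Type*} [MetricSpace X] [Group G] [MulAction G X]
    (o : X) (H : Subgroup G) (n Δ : ℝ) : Set G :=
  {h : G | h ∈ H ∧ |dist o (h • o) - n| ≤ Δ}

/-- Evaluation of a formal alternating word `a₁b₁a₂b₂⋯aₙbₙ` in `G`. -/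
def evalWord {G : Type*} [Group G] (w : List (G × G)) : G :=
  (w.map fun p => p.1 * p.2).prod

/-- The set `𝕎(A, B)` of (nonempty) formal alternating words with letters in `A` and `B`. -/
def AltWords {G : Type*} [Group G] (A B : Set G) : Set (List (G × G)) :=
  {w | w ≠ [] ∧ ∀ p ∈ w, p.1 ∈ A ∧ p.2 ∈ B}

/-- The nearest-point projection `π_A(x)` of a point to a subset `A ⊆ X`. -/
def projSet {X : Type*} [MetricSpace X] (A : Set X) (x : X) : Set X :=
  {a ∈ A | dist x a = Metric.infDist x A}

/-- The projection `π_A(Y) = ⋃_{y ∈ Y} π_A(y)` of a subset `Y` to `A`. -/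
def projSetOf {X : Type*} [MetricSpace X] (A Y : Set X) : Set X :=
  ⋃ y ∈ Y, projSet A y


section Paths

/-- The concatenation of `γ₁` restricted to `[0, L]` with `γ₂`. -/
noncomputable def concatPath {X : Type*} (γ₁ : ℝ → X) (L : ℝ) (γ₂ : ℝ → X) : ℝ → X :=
  fun t => if t ≤ L then γ₁ t else γ₂ (t - L)

lemma concatPath_of_le {X : Type*} {γ₁ γ₂ : ℝ → X} {L t : ℝ} (h : t ≤ L) :
    concatPath γ₁ L γ₂ t = γ₁ t := if_pos h

lemma concatPath_add {X : Type*} {γ₁ γ₂ : ℝ → X} {L t : ℝ} (h : γ₁ L = γ₂ 0) (ht : 0 ≤ t) :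
    concatPath γ₁ L γ₂ (L + t) = γ₂ t := by
  rcases ht.eq_or_lt with rfl | ht
  · simp [concatPath, h]
  · simp [concatPath, ht]

variable {X : Type*} [MetricSpace X]

/-- `γ` is a geodesic from `x` to `y`, parametrized by arc length on `[0, dist x y]`. -/
def IsGeodesicBetween (γ : ℝ → X) (x y : X) : Prop :=
  γ 0 = x ∧ γ (dist x y) = y ∧ IsGeodesicOn γ (dist x y)

lemma IsGeodesicOn.dist_eq {γ : ℝ → X} {L : ℝ} (h : IsGeodesicOn γ L) {s t : ℝ} (hs : 0 ≤ s)
    (hst : s ≤ t) (ht : t ≤ L) : dist (γ s) (γ t) = t - s := by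
  rw [h s t ⟨hs, hst.trans ht⟩ ⟨hs.trans hst, ht⟩, abs_sub_comm, abs_of_nonneg (sub_nonneg.2 hst)]

lemma IsGeodesicOn.mono {γ : ℝ → X} {L L' : ℝ} (h : IsGeodesicOn γ L) (hL : L' ≤ L) :
    IsGeodesicOn γ L' :=
  fun s t hs ht => h s t ⟨hs.1, hs.2.trans hL⟩ ⟨ht.1, ht.2.trans hL⟩

lemma IsGeodesicOn.shift {γ : ℝ → X} {L s t : ℝ} (h : IsGeodesicOn γ L) (hs : 0 ≤ s)
    (ht : t ≤ L) : IsGeodesicOn (fun u => γ (s + u)) (t - s) := by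
  intro u v hu hv
  rw [h (s + u) (s + v) ⟨by linarith [hu.1], by linarith [hu.2]⟩
    ⟨by linarith [hv.1], by linarith [hv.2]⟩]
  congr 1; ring

lemma IsGeodesicOn.reverse {γ : ℝ → X} {L : ℝ} (h : IsGeodesicOn γ L) :
    IsGeodesicOn (fun u => γ (L - u)) L := by
  intro u v hu hv
  rw [h (L - u) (L - v) ⟨by linarith [hu.2], by linarith [hu.1]⟩
    ⟨by linarith [hv.2], by linarith [hv.1]⟩, abs_sub_comm]
  congr 1; ring

lemma IsGeodesicBetween.reverse {γ : ℝ → X} {x y : X} (h : IsGeodesicBetween γ x y) :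
    IsGeodesicBetween (fun u => γ (dist x y - u)) y x := by
  refine ⟨by simp [h.2.1], by simp [dist_comm y x, h.1], ?_⟩
  rw [dist_comm y x]
  exact h.2.2.reverse

lemma IsGeodesicOn.isQuasiGeodesicOn {γ : ℝ → X} {L lam c : ℝ} (h : IsGeodesicOn γ L)
    (hlam : 1 ≤ lam) (hc : 0 ≤ c) : IsQuasiGeodesicOn γ L lam c := by
  refine ⟨fun s t hs hst ht => (h.dist_eq hs hst ht).le, fun s t hs hst ht => ?_⟩
  rw [h.dist_eq hs hst ht]
  nlinarith

lemma IsQuasiGeodesicOn.weaken {γ : ℝ → X} {L lam c lam' c' : ℝ}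
    (h : IsQuasiGeodesicOn γ L lam c) (hlam : lam ≤ lam') (hc : c ≤ c') :
    IsQuasiGeodesicOn γ L lam' c' := by
  refine ⟨h.1, fun s t hs hst ht => (h.2 s t hs hst ht).trans ?_⟩
  have := mul_le_mul_of_nonneg_right hlam (dist_nonneg (x := γ s) (y := γ t))
  linarith

lemma IsQuasiGeodesicOn.shift {γ : ℝ → X} {L lam c s t : ℝ} (h : IsQuasiGeodesicOn γ L lam c)
    (hs : 0 ≤ s) (ht : t ≤ L) : IsQuasiGeodesicOn (fun u => γ (s + u)) (t - s) lam c := by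
  refine ⟨fun u v hu huv hv => ?_, fun u v hu huv hv => ?_⟩
  · have := h.1 (s + u) (s + v) (by linarith) (by linarith) (by linarith)
    simpa using this
  · have := h.2 (s + u) (s + v) (by linarith) (by linarith) (by linarith)
    simpa using this

lemma IsQuasiGeodesicOn.reverse {γ : ℝ → X} {L lam c : ℝ} (h : IsQuasiGeodesicOn γ L lam c) :
    IsQuasiGeodesicOn (fun u => γ (L - u)) L lam c := by
  refine ⟨fun u v hu huv hv => ?_, fun u v hu huv hv => ?_⟩
  · have := h.1 (L - v) (L - u) (by linarith) (by linarith) (by linarith)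
    rw [dist_comm]; linarith
  · have := h.2 (L - v) (L - u) (by linarith) (by linarith) (by linarith)
    rw [dist_comm]; linarith

lemma IsQuasiGeodesicOn.congr {γ γ' : ℝ → X} {L lam c : ℝ} (h : IsQuasiGeodesicOn γ L lam c)
    (hγ : ∀ u, 0 ≤ u → u ≤ L → γ' u = γ u) : IsQuasiGeodesicOn γ' L lam c := by
  refine ⟨fun s t hs hst ht => ?_, fun s t hs hst ht => ?_⟩ <;>
    rw [hγ s hs (hst.trans ht), hγ t (hs.trans hst) ht]
  exacts [h.1 s t hs hst ht, h.2 s t hs hst ht]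

/-- A path that is a quasi-geodesic on both sides of `L₁` is a quasi-geodesic as soon as the
defining inequality holds across `L₁`. -/
lemma IsQuasiGeodesicOn.glue {γ : ℝ → X} {L₁ L₂ lam c : ℝ}
    (h₁ : IsQuasiGeodesicOn γ L₁ lam c) (h₂ : IsQuasiGeodesicOn (fun u => γ (L₁ + u)) L₂ lam c)
    (h : ∀ u v, 0 ≤ u → u ≤ L₁ → 0 ≤ v → v ≤ L₂ →
      (L₁ - u) + v ≤ lam * dist (γ u) (γ (L₁ + v)) + c) :
    IsQuasiGeodesicOn γ (L₁ + L₂) lam c := by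
  refine ⟨fun s t hs hst ht => ?_, fun s t hs hst ht => ?_⟩
  · rcases le_total t L₁ with h1 | h1
    · exact h₁.1 s t hs hst h1
    rcases le_total L₁ s with h2 | h2
    · have := h₂.1 (s - L₁) (t - L₁) (by linarith) (by linarith) (by linarith)
      simpa using this
    · have a := h₁.1 s L₁ hs h2 le_rfl
      have b := h₂.1 0 (t - L₁) le_rfl (by linarith) (by linarith)
      simp only [add_zero, add_sub_cancel, sub_zero] at b
      linarith [dist_triangle (γ s) (γ L₁) (γ t)]
  · rcases le_total t L₁ with h1 | h1
    · exact h₁.2 s t hs hst h1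
    rcases le_total L₁ s with h2 | h2
    · have := h₂.2 (s - L₁) (t - L₁) (by linarith) (by linarith) (by linarith)
      simpa using this
    · have := h s (t - L₁) hs h2 (by linarith) (by linarith)
      simp only [add_sub_cancel] at this
      linarith

lemma isQuasiGeodesicOn_concatPath {γ₁ γ₂ : ℝ → X} {L₁ L₂ lam c : ℝ}
    (h₁ : IsQuasiGeodesicOn γ₁ L₁ lam c) (h₂ : IsQuasiGeodesicOn γ₂ L₂ lam c)
    (h₁₂ : γ₁ L₁ = γ₂ 0)
    (h : ∀ u v, 0 ≤ u → u ≤ L₁ → 0 ≤ v → v ≤ L₂ →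
      (L₁ - u) + v ≤ lam * dist (γ₁ u) (γ₂ v) + c) :
    IsQuasiGeodesicOn (concatPath γ₁ L₁ γ₂) (L₁ + L₂) lam c := by
  refine IsQuasiGeodesicOn.glue (h₁.congr fun u _ hu => concatPath_of_le hu)
    (h₂.congr fun u hu _ => concatPath_add h₁₂ hu) fun u v hu hu' hv hv' => ?_
  rw [concatPath_of_le hu', concatPath_add h₁₂ hv]
  exact h u v hu hu' hv hv'

/-- Concatenating three quasi-geodesics. -/
lemma exists_concat_three {γ₁ γ₂ γ₃ : ℝ → X} {L₁ L₂ L₃ lam c : ℝ} (hL₁ : 0 ≤ L₁)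
    (hL₂ : 0 ≤ L₂) (hL₃ : 0 ≤ L₃) (h₁ : IsQuasiGeodesicOn γ₁ L₁ lam c)
    (h₂ : IsQuasiGeodesicOn γ₂ L₂ lam c) (h₃ : IsQuasiGeodesicOn γ₃ L₃ lam c)
    (h₁₂ : γ₁ L₁ = γ₂ 0) (h₂₃ : γ₂ L₂ = γ₃ 0)
    (H₁₂ : ∀ u v, 0 ≤ u → u ≤ L₁ → 0 ≤ v → v ≤ L₂ →
      (L₁ - u) + v ≤ lam * dist (γ₁ u) (γ₂ v) + c)
    (H₂₃ : ∀ v w, 0 ≤ v → v ≤ L₂ → 0 ≤ w → w ≤ L₃ →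
      (L₂ - v) + w ≤ lam * dist (γ₂ v) (γ₃ w) + c)
    (H₁₃ : ∀ u w, 0 ≤ u → u ≤ L₁ → 0 ≤ w → w ≤ L₃ →
      (L₁ - u) + L₂ + w ≤ lam * dist (γ₁ u) (γ₃ w) + c) :
    ∃ (γ : ℝ → X) (L : ℝ), 0 ≤ L ∧ IsQuasiGeodesicOn γ L lam c ∧ γ 0 = γ₁ 0 ∧ γ L = γ₃ L₃ ∧
      ∀ v, 0 ≤ v → v ≤ L₂ → ∃ u ∈ Icc 0 L, γ u = γ₂ v := by
  have e0 : concatPath γ₁ L₁ γ₂ (L₁ + L₂) = γ₃ 0 := by rw [concatPath_add h₁₂ hL₂, h₂₃]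
  refine ⟨concatPath (concatPath γ₁ L₁ γ₂) (L₁ + L₂) γ₃, L₁ + L₂ + L₃, by positivity,
    isQuasiGeodesicOn_concatPath
      (isQuasiGeodesicOn_concatPath h₁ h₂ h₁₂ H₁₂) h₃ e0 ?_, ?_, concatPath_add e0 hL₃, ?_⟩
  · intro u w hu hu' hw hw'
    rcases le_total u L₁ with h | h
    · rw [concatPath_of_le h]
      linarith [H₁₃ u w hu h hw hw']
    · obtain ⟨v, rfl⟩ : ∃ v, u = L₁ + v := ⟨u - L₁, by ring⟩
      rw [concatPath_add h₁₂ (by linarith)]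
      linarith [H₂₃ v w (by linarith) (by linarith) hw hw']
  · rw [concatPath_of_le (by positivity), concatPath_of_le hL₁]
  · intro v hv hv'
    refine ⟨L₁ + v, ⟨by positivity, by linarith⟩, ?_⟩
    rw [concatPath_of_le (by linarith), concatPath_add h₁₂ hv]

/-- A quasi-geodesic can be extended by short geodesics at both ends. -/
lemma exists_extension (hgeo : GeodesicSpace X) {ζ : ℝ → X} {L lam c B : ℝ} (hlam : 1 ≤ lam)
    (hc : 0 ≤ c) (hL : 0 ≤ L) (hζ : IsQuasiGeodesicOn ζ L lam c) {p q : X}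
    (hp : dist p (ζ 0) ≤ B) (hq : dist (ζ L) q ≤ B) :
    ∃ (γ : ℝ → X) (L' : ℝ), 0 ≤ L' ∧ IsQuasiGeodesicOn γ L' lam (c + 2 * B * (1 + lam)) ∧
      γ 0 = p ∧ γ L' = q ∧ ∀ v, 0 ≤ v → v ≤ L → ∃ u ∈ Icc 0 L', γ u = ζ v := by
  obtain ⟨σ, hσ0, hσ1, hσ⟩ := hgeo p (ζ 0)
  obtain ⟨τ, hτ0, hτ1, hτ⟩ := hgeo (ζ L) q
  have hB : 0 ≤ B := dist_nonneg.trans hp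
  have hc' : c ≤ c + 2 * B * (1 + lam) := by nlinarith
  have hlB : 0 ≤ lam * B := by positivity
  have key := exists_concat_three dist_nonneg hL dist_nonneg
    (hσ.isQuasiGeodesicOn hlam (hc.trans hc')) (hζ.weaken le_rfl hc')
    (hτ.isQuasiGeodesicOn hlam (hc.trans hc')) hσ1 hτ0.symm ?_ ?_ ?_
  · rwa [hσ0, hτ1] at key
  · intro u v hu hu' hv hv'
    have h1 := hζ.2 0 v le_rfl hv hv'
    have h2 := hσ.dist_eq hu hu' le_rfl
    rw [hσ1] at h2
    have h3 : dist (ζ 0) (ζ v) ≤ B + dist (σ u) (ζ v) := by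
      linarith [dist_triangle (ζ 0) (σ u) (ζ v), dist_comm (σ u) (ζ 0)]
    nlinarith [mul_le_mul_of_nonneg_left h3 (zero_le_one.trans hlam)]
  · intro v w hv hv' hw hw'
    have h1 := hζ.2 v L hv hv' le_rfl
    have h2 := hτ.dist_eq le_rfl hw hw'
    rw [hτ0] at h2
    have h3 : dist (ζ v) (ζ L) ≤ B + dist (ζ v) (τ w) := by
      linarith [dist_triangle (ζ v) (τ w) (ζ L), dist_comm (τ w) (ζ L)]
    nlinarith [mul_le_mul_of_nonneg_left h3 (zero_le_one.trans hlam)]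
  · intro u w hu hu' hw hw'
    have h1 := hζ.2 0 L le_rfl hL le_rfl
    have h2 := hσ.dist_eq hu hu' le_rfl
    rw [hσ1] at h2
    have h2' := hτ.dist_eq le_rfl hw hw'
    rw [hτ0] at h2'
    have h3 : dist (ζ 0) (ζ L) ≤ 2 * B + dist (σ u) (τ w) := by
      linarith [dist_triangle4 (ζ 0) (σ u) (τ w) (ζ L), dist_comm (σ u) (ζ 0),
        dist_comm (τ w) (ζ L)]
    nlinarith [mul_le_mul_of_nonneg_left h3 (zero_le_one.trans hlam)]

/-- If `β b` and `β a` are nearest points to `y` and `x` on a geodesic `β`, with `y` close to `β`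
relative to `a - b`, then the path from `y` to `x` through `β b` and `β a` is a quasi-geodesic with
uniform constants. -/
lemma exists_through_projections (hgeo : GeodesicSpace X) {β : ℝ → X} {L A a b : ℝ}
    (hβ : IsGeodesicOn β L) (hb : 0 ≤ b) (ha : a ≤ L) {x y : X}
    (hy : ∀ r, 0 ≤ r → r ≤ L → dist y (β b) ≤ dist y (β r))
    (hx : ∀ r, 0 ≤ r → r ≤ L → dist x (β a) ≤ dist x (β r))
    (hyA : dist y (β b) ≤ A) (hab : 8 * A ≤ a - b) :
    ∃ (γ : ℝ → X) (L' : ℝ), 0 ≤ L' ∧ IsQuasiGeodesicOn γ L' 5 0 ∧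
      γ 0 = y ∧ γ L' = x ∧ ∀ r, b ≤ r → r ≤ a → ∃ u ∈ Icc 0 L', γ u = β r := by
  obtain ⟨σ, hσ0, hσ1, hσ⟩ := hgeo y (β b)
  obtain ⟨τ, hτ0, hτ1, hτ⟩ := hgeo (β a) x
  have hA : 0 ≤ A := dist_nonneg.trans hyA
  have hba : b ≤ a := by linarith
  have key := exists_concat_three (lam := 5) (c := 0) dist_nonneg (sub_nonneg.2 hba) dist_nonneg
    (hσ.isQuasiGeodesicOn (by norm_num) le_rfl)
    ((hβ.shift hb ha).isQuasiGeodesicOn (by norm_num) le_rfl)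
    (hτ.isQuasiGeodesicOn (by norm_num) le_rfl) (by simp [hσ1]) (by simp [hτ0]) ?_ ?_ ?_
  · rw [hσ0, hτ1] at key
    obtain ⟨γ, L', h1, h2, h3, h4, h5⟩ := key
    refine ⟨γ, L', h1, h2, h3, h4, fun r hr hr' => ?_⟩
    simpa using h5 (r - b) (by linarith) (by linarith)
  · intro u v hu hu' hv hv'
    have h1 := hσ.dist_eq hu hu' le_rfl
    have h2 := hσ.dist_eq le_rfl hu hu'
    rw [hσ1] at h1
    rw [hσ0] at h2
    have h3 := hβ.dist_eq hb (show b ≤ b + v by linarith) (by linarith)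
    have h4 := hy (b + v) (by linarith) (by linarith)
    have h5 := dist_triangle y (σ u) (β (b + v))
    have h6 := dist_triangle (β b) (σ u) (β (b + v))
    linarith [dist_comm (σ u) (β b)]
  · intro v w hv hv' hw hw'
    have h1 := hτ.dist_eq hw hw' le_rfl
    have h2 := hτ.dist_eq le_rfl hw hw'
    rw [hτ1] at h1
    rw [hτ0] at h2
    have h3 := hβ.dist_eq (show 0 ≤ b + v by linarith) (show b + v ≤ a by linarith) ha
    have h4 := hx (b + v) (by linarith) (by linarith)
    have h5 := dist_triangle x (τ w) (β (b + v))
    have h6 := dist_triangle (β (b + v)) (τ w) (β a)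
    linarith [dist_comm (τ w) (β a), dist_comm x (τ w), dist_comm (τ w) (β (b + v)),
      dist_comm x (β a)]
  · intro u w hu hu' hw hw'
    have h1 := hσ.dist_eq hu hu' le_rfl
    rw [hσ1] at h1
    have h1' := hτ.dist_eq hw hw' le_rfl
    have h2 := hτ.dist_eq le_rfl hw hw'
    rw [hτ1] at h1'
    rw [hτ0] at h2
    have h3 := hβ.dist_eq hb hba ha
    have h4 := hx b hb (by linarith)
    have h5 := dist_triangle4 x (τ w) (σ u) (β b)
    have h6 := dist_triangle4 (β b) (σ u) (τ w) (β a)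
    linarith [dist_comm (τ w) (β a), dist_comm (β b) (σ u), dist_comm x (τ w),
      dist_comm (τ w) (σ u), dist_comm x (β a)]

end Paths

section Morse

variable {X : Type*} [MetricSpace X]

lemma IsMorseOn.mono {γ : ℝ → X} {L : ℝ} {M M' : ℝ → ℝ → ℝ} (h : IsMorseOn γ L M)
    (hM : ∀ lam c, M lam c ≤ M' lam c) : IsMorseOn γ L M' := by
  intro lam c hlam hc β Lβ hLβ hβ s t hs hst ht h0 h1 u hu
  obtain ⟨v, hv, h⟩ := h lam c hlam hc β Lβ hLβ hβ s t hs hst ht h0 h1 u hu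
  exact ⟨v, hv, h.trans (hM _ _)⟩

lemma IsMorseOn.congr {γ γ' : ℝ → X} {L : ℝ} {M : ℝ → ℝ → ℝ} (h : IsMorseOn γ L M)
    (hγ : ∀ u, 0 ≤ u → u ≤ L → γ' u = γ u) : IsMorseOn γ' L M := by
  intro lam c hlam hc β Lβ hLβ hβ s t hs hst ht h0 h1 u hu
  rw [hγ s hs (hst.trans ht)] at h0
  rw [hγ t (hs.trans hst) ht] at h1
  obtain ⟨v, hv, h⟩ := h lam c hlam hc β Lβ hLβ hβ s t hs hst ht h0 h1 u hu
  exact ⟨v, hv, by rwa [hγ v (hs.trans hv.1) (hv.2.trans ht)]⟩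

lemma IsMorseOn.shift {γ : ℝ → X} {L s t : ℝ} {M : ℝ → ℝ → ℝ} (h : IsMorseOn γ L M)
    (hs : 0 ≤ s) (ht : t ≤ L) : IsMorseOn (fun u => γ (s + u)) (t - s) M := by
  intro lam c hlam hc β Lβ hLβ hβ s' t' hs' hst' ht' h0 h1 u hu
  obtain ⟨v, hv, h⟩ := h lam c hlam hc β Lβ hLβ hβ (s + s') (s + t') (by linarith)
    (by linarith) (by linarith) h0 h1 u hu
  exact ⟨v - s, ⟨by linarith [hv.1], by linarith [hv.2]⟩, by simpa using h⟩

lemma IsMorseOn.reverse {γ : ℝ → X} {L : ℝ} {M : ℝ → ℝ → ℝ} (h : IsMorseOn γ L M) :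
    IsMorseOn (fun u => γ (L - u)) L M := by
  intro lam c hlam hc β Lβ hLβ hβ s t hs hst ht h0 h1 u hu
  obtain ⟨v, hv, h⟩ := h lam c hlam hc (fun u => β (Lβ - u)) Lβ hLβ hβ.reverse (L - t) (L - s)
    (by linarith) (by linarith) (by linarith) (by simpa using h1) (by simpa using h0) (Lβ - u)
    ⟨by linarith [hu.2], by linarith [hu.1]⟩
  exact ⟨L - v, ⟨by linarith [hv.2], by linarith [hv.1]⟩, by simpa using h⟩

lemma IsQuasiGeodesicOn.continuousOn {γ : ℝ → X} {L lam c : ℝ}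
    (h : IsQuasiGeodesicOn γ L lam c) : ContinuousOn γ (Icc 0 L) := by
  have : LipschitzOnWith 1 γ (Icc 0 L) := by
    refine LipschitzOnWith.of_dist_le_mul fun s hs t ht => ?_
    rw [NNReal.coe_one, one_mul, Real.dist_eq]
    rcases le_total s t with hst | hst
    · rw [abs_sub_comm, abs_of_nonneg (sub_nonneg.2 hst)]
      exact h.1 s t hs.1 hst ht.2
    · rw [abs_of_nonneg (sub_nonneg.2 hst), dist_comm]
      exact h.1 t s ht.1 hst hs.2
  exact this.continuousOn

/-- A quasi-geodesic with endpoints near a Morse path stays near that path. -/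
lemma IsMorseOn.exists_near (hgeo : GeodesicSpace X) {γ : ℝ → X} {L : ℝ} {M : ℝ → ℝ → ℝ}
    (h : IsMorseOn γ L M) {ζ : ℝ → X} {Lζ lam c B : ℝ} (hlam : 1 ≤ lam) (hc : 0 ≤ c)
    (hLζ : 0 ≤ Lζ) (hζ : IsQuasiGeodesicOn ζ Lζ lam c) {s t : ℝ} (hs : 0 ≤ s) (hst : s ≤ t)
    (ht : t ≤ L) (h0 : dist (ζ 0) (γ s) ≤ B) (h1 : dist (ζ Lζ) (γ t) ≤ B) {u : ℝ} (hu : 0 ≤ u)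
    (hu' : u ≤ Lζ) : ∃ v ∈ Icc s t, dist (ζ u) (γ v) ≤ M lam (c + 2 * B * (1 + lam)) := by
  obtain ⟨ζ', L', hL', hζ', e0, e1, H⟩ := exists_extension hgeo hlam hc hLζ hζ
    (by rwa [dist_comm]) h1
  obtain ⟨u', hu', e⟩ := H u hu hu'
  have hB : 0 ≤ B := dist_nonneg.trans h0
  rw [← e]
  exact h lam _ hlam (by positivity) ζ' L' hL' hζ' s t hs hst ht e0 e1 u' hu'

lemma IsGeodesicOn.exists_near (hgeo : GeodesicSpace X) {γ : ℝ → X} {L : ℝ} {M : ℝ → ℝ → ℝ}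
    (h : IsMorseOn γ L M) {ζ : ℝ → X} {Lζ B : ℝ} (hζ : IsGeodesicOn ζ Lζ)
    (hLζ : 0 ≤ Lζ) {s t : ℝ} (hs : 0 ≤ s) (hst : s ≤ t)
    (ht : t ≤ L) (h0 : dist (ζ 0) (γ s) ≤ B) (h1 : dist (ζ Lζ) (γ t) ≤ B) {u : ℝ} (hu : 0 ≤ u)
    (hu' : u ≤ Lζ) : ∃ v ∈ Icc s t, dist (ζ u) (γ v) ≤ M 1 (4 * B) := by
  have := h.exists_near hgeo le_rfl le_rfl hLζ (hζ.isQuasiGeodesicOn le_rfl le_rfl) hs hst ht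
    h0 h1 hu hu'
  convert this using 5
  ring

/-- A path both of whose halves are Morse is Morse. -/
lemma IsMorseOn.glue (hgeo : GeodesicSpace X) {γ : ℝ → X} {L₁ L₂ : ℝ} {M : ℝ → ℝ → ℝ}
    (h₁ : IsMorseOn γ L₁ M)
    (h₂ : IsMorseOn (fun u => γ (L₁ + u)) L₂ M) :
    IsMorseOn γ (L₁ + L₂) (fun lam c => max (M lam c) (M (2 * lam + 1) c)) := by
  intro lam c hlam hc ζ Lζ hLζ hζ s t hs hst ht h0 h1 u hu
  have H₂ : ∀ lam c : ℝ, 1 ≤ lam → 0 ≤ c → ∀ (β : ℝ → X) (Lβ : ℝ), 0 ≤ Lβ →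
      IsQuasiGeodesicOn β Lβ lam c → ∀ s t : ℝ, L₁ ≤ s → s ≤ t → t ≤ L₁ + L₂ → β 0 = γ s →
      β Lβ = γ t → ∀ u ∈ Icc (0 : ℝ) Lβ, ∃ v ∈ Icc s t, dist (β u) (γ v) ≤ M lam c := by
    intro lam c hlam hc β Lβ hLβ hβ s t hs hst ht h0 h1 u hu
    obtain ⟨v, hv, hd⟩ := h₂ lam c hlam hc β Lβ hLβ hβ (s - L₁) (t - L₁) (by linarith)
      (by linarith) (by linarith) (by simpa using h0) (by simpa using h1) u hu
    exact ⟨L₁ + v, ⟨by linarith [hv.1], by linarith [hv.2]⟩, hd⟩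
  rcases le_total t L₁ with htL | htL
  · obtain ⟨v, hv, hd⟩ := h₁ lam c hlam hc ζ Lζ hLζ hζ s t hs hst htL h0 h1 u hu
    exact ⟨v, hv, hd.trans (le_max_left _ _)⟩
  rcases le_total L₁ s with hsL | hsL
  · obtain ⟨v, hv, hd⟩ := H₂ lam c hlam hc ζ Lζ hLζ hζ s t hsL hst ht h0 h1 u hu
    exact ⟨v, hv, hd.trans (le_max_left _ _)⟩
  obtain ⟨u₀, ⟨hu₀, hu₀'⟩, hmin⟩ := isCompact_Icc.exists_isMinOn (nonempty_Icc.2 hLζ)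
    (f := fun w => dist (ζ w) (γ L₁))
    (continuous_dist.comp_continuousOn (hζ.continuousOn.prodMk continuousOn_const))
  have hmin' : ∀ w, 0 ≤ w → w ≤ Lζ → dist (ζ u₀) (γ L₁) ≤ dist (ζ w) (γ L₁) :=
    fun w hw hw' => hmin ⟨hw, hw'⟩
  obtain ⟨σ, hσ0, hσ1, hσ⟩ := hgeo (ζ u₀) (γ L₁)
  have hσd : ∀ w r, 0 ≤ w → w ≤ Lζ → 0 ≤ r → r ≤ dist (ζ u₀) (γ L₁) →
      r ≤ dist (ζ w) (σ r) ∧ dist (ζ u₀) (ζ w) ≤ 2 * dist (ζ w) (σ r) := by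
    intro w r hw hw' hr hr'
    have a := hσ.dist_eq hr hr' le_rfl
    have b := hσ.dist_eq le_rfl hr hr'
    rw [hσ1] at a
    rw [hσ0] at b
    have c := hmin' w hw hw'
    have d := dist_triangle (ζ w) (σ r) (γ L₁)
    have e := dist_triangle (ζ u₀) (σ r) (ζ w)
    rw [dist_comm (σ r) (ζ w)] at e
    constructor <;> linarith
  have hlam' : (1 : ℝ) ≤ 2 * lam + 1 := by linarith
  have hσq := hσ.isQuasiGeodesicOn hlam' hc
  rcases le_total u u₀ with huu | huu
  · have hq : IsQuasiGeodesicOn (concatPath ζ u₀ σ) (u₀ + dist (ζ u₀) (γ L₁))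
        (2 * lam + 1) c := by
      refine isQuasiGeodesicOn_concatPath ?_ hσq hσ0.symm fun w r hw hw' hr hr' => ?_
      · have := (hζ.shift le_rfl hu₀').weaken (show lam ≤ 2 * lam + 1 by linarith) (le_refl c)
        simpa using this
      · obtain ⟨a, b⟩ := hσd w r hw (hw'.trans hu₀') hr hr'
        have := hζ.2 w u₀ hw hw' hu₀'
        rw [dist_comm] at this
        nlinarith [mul_le_mul_of_nonneg_left b (zero_le_one.trans hlam)]
    obtain ⟨v, hv, hd⟩ := h₁ _ c hlam' hc _ _ (by positivity) hq s L₁ hs hsL le_rfl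
      (by rw [concatPath_of_le hu₀, h0]) (by rw [concatPath_add hσ0.symm dist_nonneg, hσ1]) u
      ⟨hu.1, huu.trans (by linarith [dist_nonneg (x := ζ u₀) (y := γ L₁)])⟩
    rw [concatPath_of_le huu] at hd
    exact ⟨v, ⟨hv.1, hv.2.trans htL⟩, hd.trans (le_max_right _ _)⟩
  · set δ := dist (ζ u₀) (γ L₁)
    have hδ0 : 0 ≤ δ := dist_nonneg
    have e2 : (fun r => σ (δ - r)) δ = (fun w => ζ (u₀ + w)) 0 := by simp [hσ0]
    have hq : IsQuasiGeodesicOn (concatPath (fun r => σ (δ - r)) δ (fun w => ζ (u₀ + w)))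
        (δ + (Lζ - u₀)) (2 * lam + 1) c := by
      refine isQuasiGeodesicOn_concatPath hσq.reverse
        ((hζ.shift hu₀ le_rfl).weaken (by linarith) le_rfl) e2 fun r w hr hr' hw hw' => ?_
      obtain ⟨a, b⟩ := hσd (u₀ + w) (δ - r) (by linarith) (by linarith) (by linarith)
        (by linarith)
      have := hζ.2 u₀ (u₀ + w) hu₀ (by linarith) (by linarith)
      rw [dist_comm (σ _)]
      nlinarith [mul_le_mul_of_nonneg_left b (zero_le_one.trans hlam)]
    obtain ⟨v, hv, hd⟩ := H₂ _ c hlam' hc _ _ (by linarith) hq L₁ t le_rfl htL ht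
      (by rw [concatPath_of_le hδ0]; simp [hσ1])
      (by rw [concatPath_add e2 (by linarith)]; simp [h1]) (δ + (u - u₀))
      ⟨by linarith, by linarith [hu.2]⟩
    rw [concatPath_add e2 (by linarith)] at hd
    exact ⟨v, ⟨hsL.trans hv.1, hv.2⟩, (by simpa using hd : dist (ζ u) (γ v) ≤ _).trans
      (le_max_right _ _)⟩

/-- If two properties cover an interval and hold at its respective ends, then they hold at points
at distance at most one from each other. -/
lemma exists_close_of_cover {s t : ℝ} (hst : s ≤ t) {P Q : ℝ → Prop} (hP : P s) (hQ : Q t)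
    (h : ∀ r, s ≤ r → r ≤ t → P r ∨ Q r) :
    ∃ r r', s ≤ r ∧ r ≤ r' ∧ r' ≤ t ∧ r' ≤ r + 1 ∧ P r ∧ Q r' := by
  have hne : {r | s ≤ r ∧ r ≤ t ∧ P r}.Nonempty := ⟨s, le_rfl, hst, hP⟩
  have hbdd : BddAbove {r | s ≤ r ∧ r ≤ t ∧ P r} := ⟨t, fun r hr => hr.2.1⟩
  obtain ⟨r, ⟨hr, hr', hPr⟩, hlt⟩ := exists_lt_of_lt_csSup hne (sub_one_lt _)
  rcases le_total t (r + 1) with h1 | h1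
  · exact ⟨r, t, hr, hr', le_rfl, h1, hPr, hQ⟩
  · refine ⟨r, r + 1, hr, by linarith, h1, le_rfl, hPr, ?_⟩
    refine (h (r + 1) (by linarith) h1).resolve_left fun hP' => ?_
    have := le_csSup hbdd ⟨by linarith, h1, hP'⟩
    linarith

/-- A geodesic with endpoints near those of a Morse quasi-geodesic is Morse, with a gauge
depending only on the data. -/
lemma exists_gauge_of_near (hgeo : GeodesicSpace X) (M : ℝ → ℝ → ℝ) (lam₀ c₀ A : ℝ)
    (hlam₀ : 1 ≤ lam₀) : ∃ M' : ℝ → ℝ → ℝ, ∀ (γ γ' : ℝ → X) (L L' : ℝ), 0 ≤ L → 0 ≤ L' →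
      IsQuasiGeodesicOn γ L lam₀ c₀ → IsMorseOn γ L M → IsGeodesicOn γ' L' →
      dist (γ' 0) (γ 0) ≤ A → dist (γ' L') (γ L) ≤ A → IsMorseOn γ' L' M' := by
  set B₁ := max A (M 1 (4 * A))
  set B₂ := max B₁ (M 1 (4 * B₁))
  set B₃ := max B₂ (M 1 (4 * B₂))
  refine ⟨fun lam c => M lam (c + 2 * B₂ * (1 + lam)) + (B₃ + (lam₀ * (2 * B₃ + 1) + c₀)), ?_⟩
  intro γ γ' L L' hL hL' hγ hM hγ' h0 hA1 lam c hlam hc ζ Lζ hLζ hζ s t hs hst ht hζ0 hζ1 u hu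
  obtain ⟨t₁, ht₁, hd⟩ := hγ'.exists_near hgeo hM hL' le_rfl hL le_rfl h0 hA1 (hs.trans hst) ht
  have hdt : dist (γ' t) (γ t₁) ≤ B₁ := hd.trans (le_max_right _ _)
  obtain ⟨s₁, hs₁, hds⟩ := (hγ'.mono ht).exists_near hgeo hM (hs.trans hst) le_rfl ht₁.1 ht₁.2
    (h0.trans (le_max_left _ _)) hdt hs hst
  replace hds : dist (γ' s) (γ s₁) ≤ B₂ := hds.trans (le_max_right _ _)
  replace hdt : dist (γ' t) (γ t₁) ≤ B₂ := hdt.trans (le_max_left _ _)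
  have hmid : ∀ r, s ≤ r → r ≤ t → ∃ v ∈ Icc s₁ t₁, dist (γ' r) (γ v) ≤ B₃ := by
    intro r hr hr'
    obtain ⟨v, hv, hd⟩ := (hγ'.shift hs ht).exists_near hgeo hM (sub_nonneg.2 hst) hs₁.1 hs₁.2
      ht₁.2 (by simpa using hds) (by simpa using hdt) (u := r - s) (by linarith) (by linarith)
    exact ⟨v, hv, (by simpa using hd : dist (γ' r) (γ v) ≤ _).trans (le_max_right _ _)⟩
  obtain ⟨v, hv, hd⟩ := hM.exists_near hgeo hlam hc hLζ hζ (B := B₂) hs₁.1 hs₁.2 ht₁.2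
    (by rwa [hζ0]) (by rwa [hζ1]) hu.1 hu.2
  obtain ⟨r, r', hsr, hrr', hrt, hr1, ⟨v₁, hv₁, hd₁⟩, ⟨v₂, hv₂, hd₂⟩⟩ :=
    exists_close_of_cover hst (P := fun r => ∃ v' ∈ Icc s₁ v, dist (γ' r) (γ v') ≤ B₃)
    (Q := fun r => ∃ v' ∈ Icc v t₁, dist (γ' r) (γ v') ≤ B₃)
    ⟨s₁, ⟨le_rfl, hv.1⟩, hds.trans (le_max_left _ _)⟩
    ⟨t₁, ⟨hv.2, le_rfl⟩, hdt.trans (le_max_left _ _)⟩ (by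
      intro r hr hr'
      obtain ⟨v', hv', hd'⟩ := hmid r hr hr'
      rcases le_total v' v with hvv | hvv
      · exact Or.inl ⟨v', ⟨hv'.1, hvv⟩, hd'⟩
      · exact Or.inr ⟨v', ⟨hvv, hv'.2⟩, hd'⟩)
  have h0s : 0 ≤ s₁ := hs₁.1
  have h0t : t₁ ≤ L := ht₁.2
  have q1 := hγ.2 v₁ v₂ (h0s.trans hv₁.1) (hv₁.2.trans hv₂.1) (hv₂.2.trans h0t)
  have q2 := hγ.1 v₁ v (h0s.trans hv₁.1) hv₁.2 (hv.2.trans h0t)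
  have q3 := hγ'.dist_eq (hs.trans hsr) hrr' (hrt.trans ht)
  have q4 := dist_triangle4 (γ v₁) (γ' r) (γ' r') (γ v₂)
  rw [dist_comm (γ v₁) (γ' r)] at q4
  have q5 : lam₀ * dist (γ v₁) (γ v₂) ≤ lam₀ * (2 * B₃ + 1) :=
    mul_le_mul_of_nonneg_left (by linarith) (by linarith)
  refine ⟨r, ⟨hsr, hrr'.trans hrt⟩, ?_⟩
  have q6 := dist_triangle4 (ζ u) (γ v) (γ v₁) (γ' r)
  rw [dist_comm (γ v) (γ v₁), dist_comm (γ v₁) (γ' r)] at q6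
  linarith [hv₂.1]

end Morse

section Words

variable {X G : Type*} [MetricSpace X] [Group G] [MulAction G X]

/-- All geodesics from `o` to `a • o` are `M`-Morse. -/
def HasMorseGeodesics (o : X) (M : ℝ → ℝ → ℝ) (a : G) : Prop :=
  ∀ γ : ℝ → X, IsGeodesicBetween γ o (a • o) → IsMorseOn γ (dist o (a • o)) M

lemma HasMorseGeodesics.mono {o : X} {M M' : ℝ → ℝ → ℝ} {a : G} (h : HasMorseGeodesics o M a)
    (hM : ∀ lam c, M lam c ≤ M' lam c) : HasMorseGeodesics o M' a :=
  fun γ hγ => (h γ hγ).mono hM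

/-- Geodesics from `o` to `a • o` and to `b • o` diverge linearly, up to distance `L` from `o`. -/
def DivergeUpTo (o : X) (L lam c : ℝ) (a b : G) : Prop :=
  ∀ α β : ℝ → X, IsGeodesicBetween α o (a • o) → IsGeodesicBetween β o (b • o) →
    ∀ s t : ℝ, 0 ≤ s → s ≤ dist o (a • o) → s ≤ L → 0 ≤ t → t ≤ dist o (b • o) → t ≤ L →
      s + t ≤ lam * dist (α s) (β t) + c

lemma DivergeUpTo.symm {o : X} {L lam c : ℝ} {a b : G} (h : DivergeUpTo o L lam c a b) :
    DivergeUpTo o L lam c b a := by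
  intro α β hα hβ s t hs hs' hsL ht ht' htL
  rw [add_comm, dist_comm]
  exact h β α hβ hα t s ht ht' htL hs hs' hsL

/-- The path from `o` to `l.prod • o` obtained by concatenating translates of the paths `γ a`,
for `a` a letter of `l`. -/
noncomputable def wordPath (o : X) (γ : G → ℝ → X) : List G → ℝ → X
  | [] => fun _ => o
  | a :: l => concatPath (γ a) (dist o (a • o)) fun t => a • wordPath o γ l t

/-- The length of the path `wordPath o γ l`. -/
noncomputable def wordLength (o : X) : List G → ℝ
  | [] => 0
  | a :: l => dist o (a • o) + wordLength o l

lemma wordLength_nonneg (o : X) (l : List G) : 0 ≤ wordLength o l := by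
  induction l with
  | nil => exact le_rfl
  | cons a l ih => exact add_nonneg dist_nonneg ih

variable {o : X} {γ : G → ℝ → X}

lemma wordPath_zero (hγ : ∀ a, IsGeodesicBetween (γ a) o (a • o)) (l : List G) :
    wordPath o γ l 0 = o := by
  cases l with
  | nil => rfl
  | cons a l => rw [wordPath, concatPath_of_le dist_nonneg, (hγ a).1]

lemma wordPath_cons_add (hγ : ∀ a, IsGeodesicBetween (γ a) o (a • o)) (a : G) (l : List G)
    {t : ℝ} (ht : 0 ≤ t) :
    wordPath o γ (a :: l) (dist o (a • o) + t) = a • wordPath o γ l t :=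
  concatPath_add (by rw [(hγ a).2.1, wordPath_zero hγ]) ht

lemma wordPath_wordLength (hγ : ∀ a, IsGeodesicBetween (γ a) o (a • o)) (l : List G) :
    wordPath o γ l (wordLength o l) = l.prod • o := by
  induction l with
  | nil => simp [wordPath]
  | cons a l ih =>
    rw [wordLength, wordPath_cons_add hγ a l (wordLength_nonneg o l), ih, List.prod_cons, mul_smul]

variable [IsIsometricSMul G X]

lemma IsGeodesicOn.smul {γ : ℝ → X} {L : ℝ} (h : IsGeodesicOn γ L) (g : G) :
    IsGeodesicOn (fun u => g • γ u) L := by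
  intro s t hs ht
  rw [dist_smul]
  exact h s t hs ht

lemma IsGeodesicBetween.smul {γ : ℝ → X} {x y : X} (h : IsGeodesicBetween γ x y) (g : G) :
    IsGeodesicBetween (fun u => g • γ u) (g • x) (g • y) := by
  refine ⟨by simp only [h.1], by simp only [dist_smul, h.2.1], ?_⟩
  rw [dist_smul]
  exact h.2.2.smul g

lemma IsQuasiGeodesicOn.smul {γ : ℝ → X} {L lam c : ℝ} (h : IsQuasiGeodesicOn γ L lam c)
    (g : G) : IsQuasiGeodesicOn (fun u => g • γ u) L lam c := by
  simpa only [IsQuasiGeodesicOn, dist_smul] using h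

lemma IsMorseOn.smul {γ : ℝ → X} {L : ℝ} {M : ℝ → ℝ → ℝ} (h : IsMorseOn γ L M) (g : G) :
    IsMorseOn (fun u => g • γ u) L M := by
  intro lam c hlam hc β Lβ hLβ hβ s t hs hst ht h0 h1 u hu
  obtain ⟨v, hv, h⟩ := h lam c hlam hc (fun u => g⁻¹ • β u) Lβ hLβ (hβ.smul g⁻¹) s t hs hst ht
    (by simp [h0]) (by simp [h1]) u hu
  refine ⟨v, hv, ?_⟩
  rwa [← dist_smul g, smul_inv_smul] at h

lemma LocalMorseQuasiGeodesicOn.smul {γ : ℝ → X} {Lγ L : ℝ} {M : ℝ → ℝ → ℝ} {lam c : ℝ}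
    (h : LocalMorseQuasiGeodesicOn γ Lγ L M lam c) (g : G) :
    LocalMorseQuasiGeodesicOn (fun u => g • γ u) Lγ L M lam c := fun s t hs hst ht hL =>
  ⟨(h s t hs hst ht hL).1.smul g, (h s t hs hst ht hL).2.smul g⟩

lemma dist_inv_smul (o : X) (a : G) : dist o (a⁻¹ • o) = dist o (a • o) := by
  rw [← dist_smul a o (a⁻¹ • o), smul_inv_smul, dist_comm]

/-- Reversing a geodesic from `o` to `a • o` and translating it back to `o`. -/
lemma IsGeodesicBetween.inv {o : X} {a : G} {γ : ℝ → X} (h : IsGeodesicBetween γ o (a • o)) :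
    IsGeodesicBetween (fun u => a⁻¹ • γ (dist o (a • o) - u)) o (a⁻¹ • o) := by
  simpa using h.reverse.smul a⁻¹

lemma HasMorseGeodesics.inv {o : X} {M : ℝ → ℝ → ℝ} {a : G} (h : HasMorseGeodesics o M a) :
    HasMorseGeodesics o M a⁻¹ := by
  intro γ hγ
  have h1 := (h _ (by simpa using hγ.inv)).reverse.smul a⁻¹
  rw [dist_inv_smul] at *
  simpa using h1

lemma exists_prefix_near_wordPath (hγ : ∀ a, IsGeodesicBetween (γ a) o (a • o)) {C : ℝ}
    (hC : 0 ≤ C) (l : List G) (hl : ∀ a ∈ l, dist o (a • o) ≤ C) (t : ℝ) (ht : 0 ≤ t)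
    (ht' : t ≤ wordLength o l) :
    ∃ l', l' <+: l ∧ dist (wordPath o γ l t) (l'.prod • o) ≤ C := by
  induction l generalizing t with
  | nil => exact ⟨[], List.prefix_rfl, by simpa [wordPath] using hC⟩
  | cons a l ih =>
    rcases le_total t (dist o (a • o)) with h | h
    · refine ⟨[], List.nil_prefix, ?_⟩
      have h1 := (hγ a).2.2.dist_eq le_rfl ht h
      rw [wordPath, concatPath_of_le h, dist_comm, List.prod_nil, one_smul]
      rw [(hγ a).1] at h1
      linarith [hl a List.mem_cons_self]
    · obtain ⟨r, rfl⟩ : ∃ r, t = dist o (a • o) + r := ⟨t - dist o (a • o), by ring⟩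
      rw [wordLength] at ht'
      obtain ⟨l', hl', hd⟩ := ih (fun b hb => hl b (List.mem_cons_of_mem a hb)) r (by linarith)
        (by linarith)
      refine ⟨a :: l', List.cons_prefix_cons.2 ⟨rfl, hl'⟩, ?_⟩
      rwa [wordPath_cons_add hγ a l (by linarith), List.prod_cons, mul_smul, dist_smul]

/-- The path of a word with long Morse letters diverging at every junction is a local Morse
quasi-geodesic. -/
lemma localMorseQuasiGeodesicOn_wordPath (hgeo : GeodesicSpace X)
    (hγ : ∀ a, IsGeodesicBetween (γ a) o (a • o)) {M : ℝ → ℝ → ℝ} {L lam c : ℝ} (hlam : 1 ≤ lam)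
    (hc : 0 ≤ c) (l : List G) (hne : l ≠ [])
    (hl : ∀ a ∈ l, L ≤ dist o (a • o) ∧ HasMorseGeodesics o M a)
    (hchain : l.IsChain fun a b => DivergeUpTo o L lam c a⁻¹ b) :
    LocalMorseQuasiGeodesicOn (wordPath o γ l) (wordLength o l) L
      (fun lam c => max (M lam c) (M (2 * lam + 1) c)) lam c := by
  induction l with
  | nil => exact absurd rfl hne
  | cons a l ih =>
    intro s t hs hst ht htL
    have hA : ∀ u, u ≤ dist o (a • o) → wordPath o γ (a :: l) u = γ a u :=
      fun u hu => concatPath_of_le hu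
    have hMa := (hl a List.mem_cons_self).2 (γ a) (hγ a)
    have hqa : IsQuasiGeodesicOn (wordPath o γ (a :: l)) (dist o (a • o)) lam c :=
      ((hγ a).2.2.isQuasiGeodesicOn hlam hc).congr fun u _ hu => hA u hu
    cases l with
    | nil =>
      simp only [wordLength, add_zero] at ht
      exact ⟨hqa.shift hs ht, ((hMa.mono fun _ _ => le_max_left _ _).congr
        fun u _ hu => hA u hu).shift hs ht⟩
    | cons b l =>
      have hB : ∀ u, 0 ≤ u → u ≤ dist o (b • o) →
          wordPath o γ (a :: b :: l) (dist o (a • o) + u) = a • γ b u := by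
        intro u hu hu'
        rw [wordPath_cons_add hγ _ _ hu, wordPath, concatPath_of_le hu']
      rw [List.isChain_cons_cons] at hchain
      rcases le_total (dist o (a • o)) s with has | has
      · have h := (ih (by simp) (fun d hd => hl d (List.mem_cons_of_mem a hd)) hchain.2).smul a
          (s - dist o (a • o)) (t - dist o (a • o)) (by linarith) (by linarith)
          (by rw [wordLength] at ht; linarith) (by linarith)
        rw [sub_sub_sub_cancel_right] at h
        have e : ∀ u, 0 ≤ u → u ≤ t - s → wordPath o γ (a :: b :: l) (s + u) =
            a • wordPath o γ (b :: l) (s - dist o (a • o) + u) := by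
          intro u hu _
          rw [← wordPath_cons_add hγ _ _ (by linarith)]
          congr 1; ring
        exact ⟨h.1.congr e, h.2.congr e⟩
      · have hb := hl b (by simp)
        have hMb := (hb.2 (γ b) (hγ b)).smul a
        have htab : t ≤ dist o (a • o) + dist o (b • o) := by linarith [hb.1]
        refine ⟨?_, (IsMorseOn.glue hgeo (hMa.congr fun u _ hu => hA u hu)
          (hMb.congr hB)).shift hs htab⟩
        rcases le_total t (dist o (a • o)) with hta | hta
        · exact hqa.shift hs hta
        have e : t - s = (dist o (a • o) - s) + (t - dist o (a • o)) := by ring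
        rw [e]
        have e2 : ∀ v, 0 ≤ v → v ≤ dist o (b • o) →
            wordPath o γ (a :: b :: l) (s + (dist o (a • o) - s + v)) = a • γ b v := by
          intro v hv hv'
          rw [← hB v hv hv']
          congr 1; ring
        have hqb : IsQuasiGeodesicOn (γ b) (t - dist o (a • o)) lam c :=
          ((hγ b).2.2.mono (by linarith)).isQuasiGeodesicOn hlam hc
        refine IsQuasiGeodesicOn.glue (hqa.shift hs le_rfl)
          ((hqb.smul a).congr fun v hv hv' => e2 v hv (by linarith)) fun u v hu hu' hv hv' => ?_
        have key := hchain.1 _ _ (hγ a).inv (hγ b) (dist o (a • o) - s - u) v (by linarith)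
          (by rw [dist_inv_smul]; linarith) (by linarith) hv (by linarith) (by linarith)
        have e3 : ∀ x y : X, dist (a⁻¹ • x) y = dist x (a • y) := fun x y => by
          rw [← dist_smul a, smul_inv_smul]
        rw [e3, show dist o (a • o) - (dist o (a • o) - s - u) = s + u by ring] at key
        rwa [e2 v hv (by linarith), hA _ (by linarith)]

end Words

section MorseElements

variable {X G : Type*} [MetricSpace X] [Group G] [MulAction G X] [IsIsometricSMul G X]

/-- In a Morse local-to-global space, words with sufficiently long Morse letters diverging at every
junction give Morse quasi-geodesics, and are non-trivial. -/
lemma exists_wordPath_isMorseOn (hgeo : GeodesicSpace X) (hmltg : MorseLocalToGlobalSpace X)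
    {o : X} {γ : G → ℝ → X} (hγ : ∀ a, IsGeodesicBetween (γ a) o (a • o)) (M : ℝ → ℝ → ℝ)
    {lam c : ℝ} (hlam : 1 ≤ lam) (hc : 0 ≤ c) :
    ∃ (M' : ℝ → ℝ → ℝ) (L lam' c' : ℝ), 1 ≤ lam' ∧ ∀ l : List G, l ≠ [] →
      (∀ a ∈ l, L ≤ dist o (a • o) ∧ HasMorseGeodesics o M a) →
      (l.IsChain fun a b => DivergeUpTo o L lam c a⁻¹ b) →
      IsQuasiGeodesicOn (wordPath o γ l) (wordLength o l) lam' c' ∧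
      IsMorseOn (wordPath o γ l) (wordLength o l) M' ∧ l.prod ≠ 1 := by
  obtain ⟨M', L, lam', c', -, hlam', -, H⟩ :=
    hmltg (fun lam c => max (M lam c) (M (2 * lam + 1) c)) lam c hlam hc
  refine ⟨M', max L (c' + 1), lam', c', hlam', fun l hne hl hchain => ?_⟩
  obtain ⟨hq, hm⟩ := H _ _ (wordLength_nonneg o l) fun s t hs hst ht htL =>
    localMorseQuasiGeodesicOn_wordPath hgeo hγ hlam hc l hne hl hchain s t hs hst ht
      (htL.trans (le_max_left _ _))
  refine ⟨hq, hm, fun h1 => ?_⟩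
  have h := hq.2 0 _ le_rfl (wordLength_nonneg o l) le_rfl
  rw [wordPath_zero hγ, wordPath_wordLength hγ, h1, one_smul, dist_self] at h
  cases l with
  | nil => exact hne rfl
  | cons a l =>
    have h2 := (le_max_right L (c' + 1)).trans (hl a List.mem_cons_self).1
    rw [wordLength] at h
    linarith [wordLength_nonneg o l]

/-- A long element with Morse geodesics whose axis does not backtrack is a Morse element. -/
lemma exists_isMorseElement_of_divergeUpTo (hgeo : GeodesicSpace X)
    (hmltg : MorseLocalToGlobalSpace X) (o : X) (M : ℝ → ℝ → ℝ) {c : ℝ} (hc : 0 ≤ c) :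
    ∃ L : ℝ, ∀ e : G, L ≤ dist o (e • o) → HasMorseGeodesics o M e →
      DivergeUpTo o L 1 c e⁻¹ e → IsMorseElement o e := by
  choose γ hγ using fun a : G => hgeo o (a • o)
  replace hγ : ∀ a, IsGeodesicBetween (γ a) o (a • o) := hγ
  obtain ⟨M', L, lam', c', hlam', H⟩ := exists_wordPath_isMorseOn hgeo hmltg hγ M le_rfl hc
  obtain ⟨M'', hM''⟩ := exists_gauge_of_near hgeo M' lam' c' 0 hlam'
  refine ⟨L, fun e he hMe hde => ?_⟩
  have key : ∀ f : G, dist o (f • o) = dist o (e • o) → HasMorseGeodesics o M f →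
      DivergeUpTo o L 1 c f⁻¹ f → ∀ n : ℕ, (n ≠ 0 → f ^ n ≠ 1) ∧
      ∀ ζ : ℝ → X, IsGeodesicBetween ζ o (f ^ n • o) →
        IsMorseOn ζ (dist o (f ^ n • o)) (fun lam c => max (M'' lam c) c) ∧
        ∀ s ∈ Icc 0 (dist o (f ^ n • o)), ∃ k : ℕ,
          dist (ζ s) (f ^ k • o) ≤ max (M' 1 0) 0 + dist o (e • o) := by
    intro f hfe hMf hdf n
    rcases eq_or_ne n 0 with rfl | hn
    · refine ⟨fun h => absurd rfl h, fun ζ hζ => ?_⟩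
      simp only [pow_zero, one_smul, dist_self]
      refine ⟨fun lam c hlam hc β Lβ hLβ hβ s t hs hst ht h0 h1 u hu => ?_, fun s hs => ?_⟩
      · obtain rfl : t = 0 := by linarith
        obtain rfl : s = 0 := by linarith
        refine ⟨0, by simp, le_trans ?_ (le_max_right _ _)⟩
        have h2 := hβ.1 0 u le_rfl hu.1 hu.2
        have h3 := hβ.2 0 Lβ le_rfl hLβ le_rfl
        rw [h0, h1, dist_self] at h3
        rw [← h0, dist_comm]
        linarith [hu.2]
      · obtain rfl : s = 0 := by simpa using hs
        refine ⟨0, ?_⟩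
        rw [hζ.1, pow_zero, one_smul, dist_self]
        positivity
    · obtain ⟨hq, hm, h1⟩ := H (List.replicate n f) (by simpa using hn)
        (fun a ha => by
          rw [List.eq_of_mem_replicate ha, hfe]
          exact ⟨he, hMf⟩)
        (List.isChain_replicate_of_rel n hdf)
      rw [List.prod_replicate] at h1
      refine ⟨fun _ => h1, fun ζ hζ => ?_⟩
      have e0 : dist (ζ 0) (wordPath o γ (List.replicate n f) 0) ≤ 0 := by
        rw [hζ.1, wordPath_zero hγ, dist_self]
      have e1 : dist (ζ (dist o (f ^ n • o))) (wordPath o γ (List.replicate n f)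
          (wordLength o (List.replicate n f))) ≤ 0 := by
        rw [hζ.2.1, wordPath_wordLength hγ, List.prod_replicate, dist_self]
      refine ⟨(hM'' _ ζ _ _ (wordLength_nonneg o _) dist_nonneg hq hm hζ.2.2 e0 e1).mono
        fun _ _ => le_max_left _ _, fun s hs => ?_⟩
      obtain ⟨v, hv, hd⟩ := hζ.2.2.exists_near hgeo hm dist_nonneg le_rfl
        (wordLength_nonneg o _) le_rfl e0 e1 hs.1 hs.2
      obtain ⟨l', hl', hd'⟩ := exists_prefix_near_wordPath hγ (dist_nonneg (x := o) (y := e • o))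
        (List.replicate n f) (fun a ha => by rw [List.eq_of_mem_replicate ha, hfe]) v hv.1 hv.2
      have hl'' : l' = List.replicate l'.length f :=
        List.eq_replicate_of_mem fun a ha => List.eq_of_mem_replicate (hl'.subset ha)
      rw [hl'', List.prod_replicate] at hd'
      rw [mul_zero] at hd
      exact ⟨_, (dist_triangle _ _ _).trans
        (add_le_add (hd.trans (le_max_left _ _)) hd')⟩
  have key' := key e⁻¹ (dist_inv_smul o e) hMe.inv (by rw [inv_inv]; exact hde.symm)
  replace key := key e rfl hMe hde
  refine ⟨fun h => ?_, fun lam c => max (M'' lam c) c, max (M' 1 0) 0 + dist o (e • o),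
    by positivity, ?_⟩
  · obtain ⟨n, hn, hn1⟩ := isOfFinOrder_iff_pow_eq_one.1 h
    exact (key n).1 hn.ne' hn1
  · rintro h hh ζ h0 h1 hζ
    obtain ⟨j, rfl⟩ := Subgroup.mem_zpowers_iff.1 hh
    obtain ⟨n, rfl | rfl⟩ := j.eq_nat_or_neg
    · rw [zpow_natCast] at *
      obtain ⟨hm, hd⟩ := (key n).2 ζ ⟨h0, h1, hζ⟩
      refine ⟨hm, fun s hs => ?_⟩
      obtain ⟨k, hk⟩ := hd s hs
      exact ⟨e ^ k, Subgroup.npow_mem_zpowers e k, hk⟩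
    · rw [zpow_neg, zpow_natCast, ← inv_pow] at *
      obtain ⟨hm, hd⟩ := (key' n).2 ζ ⟨h0, h1, hζ⟩
      refine ⟨hm, fun s hs => ?_⟩
      obtain ⟨k, hk⟩ := hd s hs
      exact ⟨e⁻¹ ^ k, pow_mem (inv_mem (Subgroup.mem_zpowers e)) k, hk⟩

lemma dist_conj_smul (o : X) (a e : G) :
    dist ((a * e * a⁻¹) • o) (a • e • o) = dist o (a • o) := by
  rw [mul_smul, mul_smul, dist_smul, dist_smul, dist_comm, dist_inv_smul]

lemma exists_hasMorseGeodesics_conj (hgeo : GeodesicSpace X) (o : X) (M : ℝ → ℝ → ℝ) (A : ℝ) :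
    ∃ M' : ℝ → ℝ → ℝ, ∀ a e : G, dist o (a • o) ≤ A → HasMorseGeodesics o M e →
      HasMorseGeodesics o M' (a * e * a⁻¹) := by
  obtain ⟨M', hM'⟩ := exists_gauge_of_near hgeo M 1 0 A le_rfl
  refine ⟨M', fun a e ha he ζ hζ => ?_⟩
  obtain ⟨γ, hγ⟩ := hgeo o (e • o)
  refine hM' _ ζ _ _ dist_nonneg dist_nonneg
    ((IsGeodesicOn.isQuasiGeodesicOn hγ.2.2 le_rfl le_rfl).smul a) ((he γ hγ).smul a) hζ.2.2 ?_ ?_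
  · rwa [hζ.1, hγ.1]
  · rwa [hζ.2.1, hγ.2.1, dist_conj_smul]

lemma IsMorseElement.conj (hgeo : GeodesicSpace X) {o : X} {e : G} (h : IsMorseElement o e)
    (a : G) : IsMorseElement o (a * e * a⁻¹) := by
  obtain ⟨hfin, M, D, hD, hst⟩ := h
  obtain ⟨M', hM'⟩ := exists_hasMorseGeodesics_conj (G := G) hgeo o M (dist o (a • o))
  refine ⟨fun h => ?_, M', max (M 1 (4 * dist o (a • o))) 0 + (D + dist o (a • o)),
    by positivity, ?_⟩
  · rw [isOfFinOrder_iff_pow_eq_one] at h hfin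
    obtain ⟨n, hn, h⟩ := h
    rw [conj_pow, conj_eq_one_iff] at h
    exact hfin ⟨n, hn, h⟩
  · intro f hf ζ h0 h1 hζ
    obtain ⟨j, rfl⟩ := Subgroup.mem_zpowers_iff.1 hf
    rw [conj_zpow] at *
    have hMj : HasMorseGeodesics o M (e ^ j) := fun γ hγ =>
      (hst _ (Subgroup.zpow_mem_zpowers e j) γ hγ.1 hγ.2.1 hγ.2.2).1
    refine ⟨hM' a _ le_rfl hMj ζ ⟨h0, h1, hζ⟩, fun s hs => ?_⟩
    obtain ⟨γ, hγ0, hγ1, hγ⟩ := hgeo o (e ^ j • o)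
    obtain ⟨hm, hd⟩ := hst _ (Subgroup.zpow_mem_zpowers e j) γ hγ0 hγ1 hγ
    obtain ⟨v, hv, hv'⟩ := hζ.exists_near hgeo (hm.smul a) dist_nonneg le_rfl dist_nonneg le_rfl
      (B := dist o (a • o)) (by rw [h0, hγ0]) (by rw [h1, hγ1, dist_conj_smul]) hs.1 hs.2
    obtain ⟨f, hf, hf'⟩ := hd v hv
    obtain ⟨i, rfl⟩ := Subgroup.mem_zpowers_iff.1 hf
    refine ⟨(a * e * a⁻¹) ^ i, Subgroup.zpow_mem_zpowers _ i, ?_⟩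
    rw [← dist_smul a] at hf'
    rw [conj_zpow]
    have h2 := dist_conj_smul o a (e ^ i)
    rw [dist_comm] at h2
    have h3 := dist_triangle4 (ζ s) (a • γ v) (a • e ^ i • o) ((a * e ^ i * a⁻¹) • o)
    linarith [le_max_left (M 1 (4 * dist o (a • o))) 0]

end MorseElements

section Ray

variable {X G : Type*} [MetricSpace X] [Group G] [MulAction G X]

lemma IsMorseGeodesicRay.isGeodesicOn {γ : ℝ → X} {M : ℝ → ℝ → ℝ} (h : IsMorseGeodesicRay γ M)
    (L : ℝ) : IsGeodesicOn γ L := fun s t hs ht => h.1 s t hs.1 ht.1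

lemma IsMorseGeodesicRay.isMorseOn {γ : ℝ → X} {M : ℝ → ℝ → ℝ} (h : IsMorseGeodesicRay γ M)
    (L : ℝ) : IsMorseOn γ L M :=
  fun lam c hlam hc β Lβ hLβ hβ s t hs hst _ => h.2 lam c hlam hc β Lβ hLβ hβ s t hs hst

lemma CocompactAction.exists_dist_le (h : CocompactAction G X) [IsIsometricSMul G X] (o : X) :
    ∃ K : ℝ, 0 ≤ K ∧ ∀ x : X, ∃ g : G, dist x (g • o) ≤ K := by
  obtain ⟨S, hS, h⟩ := h
  obtain ⟨K, hK⟩ := hS.isBounded.subset_closedBall o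
  refine ⟨max K 0, le_max_right _ _, fun x => ?_⟩
  obtain ⟨g, hg⟩ := h x
  refine ⟨g⁻¹, le_trans ?_ (le_max_left _ _)⟩
  rw [← dist_smul g, smul_inv_smul]
  exact hK hg

variable [IsIsometricSMul G X]

/-- A Morse geodesic ray in a space with a proper cocompact action gives arbitrarily long elements
with uniformly Morse geodesics whose axes do not backtrack: between two long subsegments of the
ray that look alike up to translation. -/
lemma exists_divergeUpTo_inv_self (hproper : ProperAction G X) (hcocompact : CocompactAction G X)
    (hgeo : GeodesicSpace X) (o : X) {γ : ℝ → X} {M : ℝ → ℝ → ℝ} (hγ : IsMorseGeodesicRay γ M) :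
    ∃ (M' : ℝ → ℝ → ℝ) (c : ℝ), 0 ≤ c ∧ ∀ L : ℝ, ∃ e : G, L ≤ dist o (e • o) ∧
      HasMorseGeodesics o M' e ∧ DivergeUpTo o L 1 c e⁻¹ e := by
  obtain ⟨K, hK, hcov⟩ := hcocompact.exists_dist_le o
  choose g hg using fun n : ℕ => hcov (γ n)
  obtain ⟨M', hM'⟩ := exists_gauge_of_near hgeo M 1 0 K le_rfl
  set B := max (M 1 (4 * K)) 0
  have hB : 0 ≤ B := le_max_right _ _
  have hdist : ∀ m n : ℕ, dist o (((g m)⁻¹ * g n) • o) = dist (g m • o) (g n • o) := by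
    intro m n
    rw [mul_smul, ← dist_smul (g m), smul_inv_smul]
  have hle : ∀ m i : ℕ, dist (g m • o) (g (m + i) • o) ≤ i + 2 * K := by
    intro m i
    have h1 := hγ.1 m (m + i : ℕ) (by positivity) (by positivity)
    rw [Nat.cast_add, sub_add_cancel_left, abs_neg, abs_of_nonneg (by positivity)] at h1
    have h2 := dist_triangle4 (g m • o) (γ m) (γ (m + i)) (g (m + i) • o)
    have h3 := hg (m + i)
    rw [Nat.cast_add] at h3
    rw [dist_comm (g m • o) (γ m)] at h2
    linarith [hg m]
  have hge : ∀ m i : ℕ, i - 2 * K ≤ dist (g m • o) (g (m + i) • o) := by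
    intro m i
    have h1 := hγ.1 m (m + i : ℕ) (by positivity) (by positivity)
    rw [Nat.cast_add, sub_add_cancel_left, abs_neg, abs_of_nonneg (by positivity)] at h1
    have h2 := dist_triangle4 (γ m) (g m • o) (g (m + i) • o) (γ (m + i))
    have h3 := hg (m + i)
    rw [Nat.cast_add, dist_comm] at h3
    linarith [hg m]
  refine ⟨M', 4 * B + 4 * K + 2, by positivity, fun L => ?_⟩
  set R := ⌈L⌉₊
  have hLR : L ≤ R := Nat.le_ceil L
  set Q := R + ⌈2 * K⌉₊ + 1
  have hQ : L + 2 * K ≤ Q := by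
    simp only [Q]; push_cast; linarith [Nat.le_ceil (2 * K)]
  -- two indices at which the ray looks alike
  obtain ⟨m, d, hd, htype⟩ : ∃ m d : ℕ, Q ≤ d ∧
      ∀ i ≤ R, (g m)⁻¹ * g (m + i) = (g (m + d))⁻¹ * g (m + d + i) := by
    have hfin := (hproper o (R + 2 * K + 1) (by positivity)).to_subtype
    let f : ℕ → Fin (R + 1) → {h : G | dist o (h • o) ≤ R + 2 * K + 1} := fun k i =>
      ⟨(g (k * Q))⁻¹ * g (k * Q + i), by
        have h1 := hle (k * Q) i
        have h2 : ((i : ℕ) : ℝ) ≤ R := by exact_mod_cast Nat.lt_succ_iff.1 i.2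
        rw [mem_ofPred_eq, hdist]
        linarith⟩
    obtain ⟨k, k', hne, hf⟩ := Finite.exists_ne_map_eq_of_infinite f
    wlog hlt : k < k' generalizing k k'
    · exact this k' k hne.symm hf.symm (by omega)
    obtain ⟨j, rfl⟩ := Nat.exists_eq_add_of_lt hlt
    refine ⟨k * Q, (j + 1) * Q, Nat.le_mul_of_pos_left _ (Nat.succ_pos j), fun i hi => ?_⟩
    have := congrArg Subtype.val (congrFun hf ⟨i, Nat.lt_succ_iff.2 hi⟩)
    simp only [f] at this
    rw [this]
    congr 3 <;> ring
  set n := m + d with hn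
  have hmn : (m : ℝ) ≤ n := by simp [hn]
  have hnear : ∀ (ζ : ℝ → X), IsGeodesicBetween ζ (g m • o) (g n • o) →
      ∀ u, 0 ≤ u → u ≤ dist (g m • o) (g n • o) → ∃ v ∈ Icc (m : ℝ) n, dist (ζ u) (γ v) ≤ B := by
    intro ζ hζ u hu hu'
    obtain ⟨v, hv, hd⟩ := hζ.2.2.exists_near hgeo (hγ.isMorseOn n) dist_nonneg
      (Nat.cast_nonneg m) hmn le_rfl (B := K) (by rw [hζ.1, dist_comm]; exact hg m)
      (by rw [hζ.2.1, dist_comm]; exact hg n) hu hu'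
    exact ⟨v, hv, hd.trans (le_max_left _ _)⟩
  refine ⟨(g m)⁻¹ * g n, ?_, fun ζ hζ => ?_, fun α β hα hβ s t hs hs' hsL ht ht' htL => ?_⟩
  · have h1 := hge m d
    have h2 : (Q : ℝ) ≤ d := by exact_mod_cast hd
    rw [hdist]
    linarith
  · have hmn' : (0 : ℝ) ≤ n - m := by linarith
    refine hM' (fun u => (g m)⁻¹ • γ (m + u)) ζ (n - m) _ hmn' dist_nonneg ?_ ?_ hζ.2.2 ?_ ?_
    · exact (((hγ.isGeodesicOn n).isQuasiGeodesicOn le_rfl le_rfl).shift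
        (Nat.cast_nonneg m) le_rfl).smul _
    · exact ((hγ.isMorseOn n).shift (Nat.cast_nonneg m) le_rfl).smul _
    · rw [hζ.1, ← dist_smul (g m), smul_inv_smul, add_zero, dist_comm]
      exact hg m
    · rw [hζ.2.1, mul_smul, dist_smul, add_sub_cancel, dist_comm]
      exact hg n
  · rw [dist_inv_smul, hdist] at hs'
    rw [hdist] at ht'
    have hβ' : IsGeodesicBetween (fun u => g m • β u) (g m • o) (g n • o) := by
      simpa [mul_smul] using hβ.smul (g m)
    have hα' : IsGeodesicBetween (fun u => g n • α (dist (g m • o) (g n • o) - u))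
        (g m • o) (g n • o) := by
      have := (hα.smul (g n)).reverse
      rw [dist_smul, dist_inv_smul, hdist] at this
      simpa [mul_smul] using this
    obtain ⟨v, hv, hvB⟩ := hnear _ hβ' t ht ht'
    obtain ⟨w, hw, hwB⟩ := hnear _ hα' (dist (g m • o) (g n • o) - s) (by linarith) (by linarith)
    simp only [sub_sub_cancel] at hwB
    have hi := Nat.floor_le ht
    have hi' := Nat.lt_floor_add_one t
    have hiR : ⌊t⌋₊ ≤ R := (Nat.floor_le_floor htL).trans (Nat.floor_le_ceil L)
    set i := ⌊t⌋₊
    have hti := htype i hiR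
    have ht0 := hβ.2.2.dist_eq le_rfl ht (by rwa [hdist])
    have hs0 := hα.2.2.dist_eq le_rfl hs (by rwa [dist_inv_smul, hdist])
    rw [hβ.1, sub_zero, ← dist_smul (g m)] at ht0
    rw [hα.1, sub_zero, ← dist_smul (g n)] at hs0
    have hv0 := hγ.1 m v (Nat.cast_nonneg m) ((Nat.cast_nonneg m).trans hv.1)
    have hw0 := hγ.1 w n ((Nat.cast_nonneg m).trans hw.1) (Nat.cast_nonneg n)
    have hvi := hγ.1 v (m + i : ℕ) ((Nat.cast_nonneg m).trans hv.1) (Nat.cast_nonneg _)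
    have hwi := hγ.1 w (n + i : ℕ) ((Nat.cast_nonneg m).trans hw.1) (Nat.cast_nonneg _)
    rw [abs_sub_comm, abs_of_nonneg (sub_nonneg.2 hv.1)] at hv0
    rw [abs_sub_comm, abs_of_nonneg (sub_nonneg.2 hw.2)] at hw0
    have hβi : dist (g n • β t) (g (n + i) • o) ≤ 2 * B + 2 * K + 1 := by
      have e : dist (g n • β t) (g (n + i) • o) = dist (g m • β t) (g (m + i) • o) := by
        rw [← dist_smul (g n)⁻¹, inv_smul_smul, ← mul_smul, ← hti, mul_smul,
          ← dist_smul (g m), smul_inv_smul]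
      have h1 := dist_triangle4 (γ m) (g m • o) (g m • β t) (γ v)
      have h2 := dist_triangle4 (g m • o) (γ m) (γ v) (g m • β t)
      rw [dist_comm (g m • o) (γ m), dist_comm (γ v) (g m • β t)] at h2
      have h3 := dist_triangle4 (g m • β t) (γ v) (γ (m + i : ℕ)) (g (m + i) • o)
      have h4 : dist (γ v) (γ (m + i : ℕ)) ≤ B + K + 1 := by
        rw [hvi, abs_le]
        push_cast
        constructor <;> linarith [hg m]
      linarith [hg (m + i)]
    have h1 := dist_triangle4 (g n • o) (γ n) (γ w) (g n • α s)
    rw [dist_comm (g n • o) (γ n), dist_comm (γ w) (g n • α s),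
      dist_comm (γ n) (γ w)] at h1
    have h2 := dist_triangle4 (γ w) (g n • α s) (g n • β t) (γ (n + i : ℕ))
    have h3 := dist_triangle (g n • β t) (g (n + i) • o) (γ (n + i : ℕ))
    have h4 := hg (n + i)
    rw [hwi, abs_sub_comm, dist_smul, dist_comm (γ w)] at h2
    rw [dist_comm] at h4
    have h5 := le_abs_self (((n + i : ℕ) : ℝ) - w)
    have h6 : ((n + i : ℕ) : ℝ) = n + i := Nat.cast_add n i
    linarith [hg n]

end Ray

section Transversality

variable {X G : Type*} [MetricSpace X] [Group G] [MulAction G X]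

lemma IsGeodesicOn.exists_forall_dist_le {β : ℝ → X} {L : ℝ} (hβ : IsGeodesicOn β L) (hL : 0 ≤ L)
    (x : X) : ∃ a, 0 ≤ a ∧ a ≤ L ∧ ∀ r, 0 ≤ r → r ≤ L → dist x (β a) ≤ dist x (β r) := by
  have hcont := (hβ.isQuasiGeodesicOn le_rfl le_rfl).continuousOn
  obtain ⟨a, ha, hmin⟩ := isCompact_Icc.exists_isMinOn (nonempty_Icc.2 hL)
    (f := fun r => dist x (β r)) (by fun_prop)
  exact ⟨a, ha.1, ha.2, fun r hr hr' => hmin ⟨hr, hr'⟩⟩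

/-- A geodesic either passes near a Morse geodesic starting near its origin, or diverges from it
linearly. -/
lemma IsMorseOn.near_or_diverge (hgeo : GeodesicSpace X) {α β : ℝ → X} {Lα Lβ A : ℝ}
    {M : ℝ → ℝ → ℝ} (hm : IsMorseOn α Lα M) (hα : IsGeodesicOn α Lα) (hβ : IsGeodesicOn β Lβ)
    (hA : dist (α 0) (β 0) ≤ A) :
    (∃ v ∈ Icc 0 Lα, dist (β (10 * A)) (α v) ≤ M 5 0) ∨
      ∀ s t, 0 ≤ s → s ≤ Lα → 0 ≤ t → t ≤ Lβ → s + t ≤ 3 * dist (α s) (β t) + 21 * A := by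
  rw [or_iff_not_imp_left]
  intro hfar s t hs hs' ht ht'
  have hA0 : 0 ≤ A := dist_nonneg.trans hA
  have hLβ : 0 ≤ Lβ := ht.trans ht'
  obtain ⟨b, hb, hb', hminb⟩ := hβ.exists_forall_dist_le hLβ (α 0)
  obtain ⟨a, ha, ha', hmina⟩ := hβ.exists_forall_dist_le hLβ (α s)
  have hyb : dist (α 0) (β b) ≤ A := (hminb 0 le_rfl hLβ).trans hA
  have hb2 : b ≤ 2 * A := by
    have h1 := hβ.dist_eq le_rfl hb hb'
    linarith [dist_triangle_left (β 0) (β b) (α 0)]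
  have haA : a < 10 * A := by
    by_contra! haA
    obtain ⟨γ, L', hL', hγ, h0, h1, hthrough⟩ :=
      exists_through_projections hgeo hβ hb ha' hminb hmina hyb (by linarith)
    obtain ⟨u, hu, hu'⟩ := hthrough (10 * A) (by linarith) haA
    obtain ⟨v, hv, hd⟩ := hm 5 0 (by norm_num) le_rfl γ L' hL' hγ 0 s le_rfl hs hs' h0 h1 u hu
    exact hfar ⟨v, ⟨hv.1, hv.2.trans hs'⟩, hu' ▸ hd⟩
  have h1 := hα.dist_eq le_rfl hs hs'
  have h2 := hβ.dist_eq le_rfl ha ha'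
  have h3 := hβ.dist_eq le_rfl ht ht'
  have h4 := hmina t ht ht'
  have h5 := dist_triangle4 (α 0) (β 0) (β a) (α s)
  have h6 := dist_triangle4 (β 0) (β a) (α s) (β t)
  rw [dist_comm (β a)] at h5 h6
  linarith

lemma ProperAction.exists_card_cosets_le [IsIsometricSMul G X] (hproper : ProperAction G X) (o : X)
    (H : Subgroup G) (ρ : ℝ) (hρ : 0 ≤ ρ) :
    ∃ N : ℕ, ∀ (z : X) (F : Finset (G ⧸ H)),
      (∀ q ∈ F, ∃ g : G, (g : G ⧸ H) = q ∧ dist z (g • o) ≤ ρ) → F.card ≤ N := by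
  have hfin := hproper o (2 * ρ + 1) (by positivity)
  refine ⟨hfin.toFinset.card, fun z F hF => ?_⟩
  rcases F.eq_empty_or_nonempty with rfl | ⟨q₀, hq₀⟩
  · simp
  choose! f hf hf' using hF
  refine Finset.card_le_card_of_injOn (fun q => (f q₀)⁻¹ * f q) (fun q hq => ?_) ?_
  · simp only [Finite.coe_toFinset, mem_ofPred_eq, mul_smul]
    rw [← dist_smul (f q₀), smul_inv_smul]
    linarith [dist_triangle_left (f q₀ • o) (f q • o) z, hf' q hq, hf' q₀ hq₀]
  · intro q hq q' hq' h
    rw [← hf q hq, ← hf q' hq', mul_left_cancel h]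

variable [IsIsometricSMul G X]

/-- Given an infinite-index stable subgroup `H`, any two geodesics issued from `o` diverge, after
translation by a suitable element `a` of bounded length, from all geodesics with endpoints
in `H • o`. -/
lemma exists_translate_diverge (hproper : ProperAction G X) (hgeo : GeodesicSpace X) {o : X}
    {H : Subgroup G} (hstable : IsStableSubgroup o H) (hindex : H.index = 0) :
    ∃ A : ℝ, 0 ≤ A ∧ ∀ (β : Fin 2 → ℝ → X) (L : Fin 2 → ℝ), (∀ i, β i 0 = o) →
      (∀ i, IsGeodesicOn (β i) (L i)) → ∃ a : G, dist o (a • o) ≤ A ∧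
        ∀ i, ∀ h ∈ H, ∀ α : ℝ → X, IsGeodesicBetween α o (h • o) → ∀ s t, 0 ≤ s →
          s ≤ dist o (h • o) → 0 ≤ t → t ≤ L i →
            s + t ≤ 3 * dist (α s) (a • β i t) + 21 * A := by
  classical
  obtain ⟨M, D, hD, hst⟩ := hstable
  obtain ⟨N, hN⟩ := hproper.exists_card_cosets_le o H (max (M 5 0) 0 + D) (by positivity)
  have := Subgroup.index_eq_zero_iff_infinite.1 hindex
  obtain ⟨F, hF⟩ := Infinite.exists_subset_card_eq (G ⧸ H) (2 * N + 1)
  refine ⟨∑ q ∈ F, dist o ((q.out : G)⁻¹ • o), Finset.sum_nonneg fun _ _ => dist_nonneg, ?_⟩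
  set A := ∑ q ∈ F, dist o ((q.out : G)⁻¹ • o)
  intro β L hβ0 hβ
  let bad : Fin 2 → Finset (G ⧸ H) := fun i =>
    F.filter fun q => ∃ g : G, (g : G ⧸ H) = q ∧ dist (β i (10 * A)) (g • o) ≤ max (M 5 0) 0 + D
  have hbad : ∀ i, (bad i).card ≤ N := fun i =>
    hN (β i (10 * A)) (bad i) fun q hq => (Finset.mem_filter.1 hq).2
  obtain ⟨q, hqF, hq⟩ : ∃ q ∈ F, q ∉ bad 0 ∪ bad 1 := by
    by_contra! h
    have h1 := (Finset.card_le_card h).trans (Finset.card_union_le _ _)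
    have h2 := hbad 0
    have h3 := hbad 1
    omega
  have hq' : ∀ i, q ∉ bad i := by
    rw [Finset.mem_union, not_or] at hq
    exact Fin.forall_fin_two.2 hq
  have hqA : dist o ((q.out : G)⁻¹ • o) ≤ A :=
    Finset.single_le_sum (f := fun q : G ⧸ H => dist o ((q.out : G)⁻¹ • o))
      (fun _ _ => dist_nonneg) hqF
  refine ⟨(q.out : G)⁻¹, hqA, fun i h hh α hα s t hs hs' ht ht' => ?_⟩
  obtain ⟨hm, hd⟩ := hst h hh α hα.1 hα.2.1 hα.2.2
  have hoff := (hm.smul (q.out : G)).near_or_diverge hgeo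
    (IsGeodesicOn.smul hα.2.2 (q.out : G)) (hβ i) (A := A)
    (by rwa [hα.1, hβ0, dist_comm, ← dist_inv_smul])
  have e : ∀ x y : X, dist x ((q.out : G)⁻¹ • y) = dist ((q.out : G) • x) y := fun x y => by
    rw [← dist_smul (q.out : G), smul_inv_smul]
  rw [e]
  refine hoff.resolve_left ?_ s t hs hs' ht ht'
  rintro ⟨v, hv, hv'⟩
  obtain ⟨h', hh', hd'⟩ := hd v hv
  refine hq' i (Finset.mem_filter.2 ⟨hqF, q.out * h', ?_, ?_⟩)
  · rw [QuotientGroup.mk_mul_of_mem _ hh', QuotientGroup.out_eq']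
  · rw [← dist_smul (q.out : G), ← mul_smul] at hd'
    exact (dist_triangle _ _ _).trans (add_le_add (hv'.trans (le_max_left _ _)) hd')

/-- Given an infinite-index stable subgroup `H`, every element with Morse geodesics has a
conjugate whose axis diverges from `H`. -/
lemma exists_conj_divergeUpTo (hproper : ProperAction G X) (hgeo : GeodesicSpace X) {o : X}
    {H : Subgroup G} (hstable : IsStableSubgroup o H) (hindex : H.index = 0) (M : ℝ → ℝ → ℝ) :
    ∃ A c : ℝ, 0 ≤ c ∧ ∀ e : G, HasMorseGeodesics o M e →
      ∃ a : G, dist o (a • o) ≤ A ∧ ∀ h ∈ H, ∀ L : ℝ,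
        DivergeUpTo o L 3 c h (a * e * a⁻¹) ∧ DivergeUpTo o L 3 c h (a * e * a⁻¹)⁻¹ := by
  obtain ⟨A, hA, key⟩ := exists_translate_diverge hproper hgeo hstable hindex
  set B := max (M 1 (4 * A)) 0
  have hB : 0 ≤ B := le_max_right _ _
  refine ⟨A, 22 * A + 4 * B, by positivity, fun e hMe => ?_⟩
  obtain ⟨β₀, hβ₀⟩ := hgeo o (e • o)
  obtain ⟨β₁, hβ₁⟩ := hgeo o (e⁻¹ • o)
  obtain ⟨a, ha, hdiv⟩ := key ![β₀, β₁] ![dist o (e • o), dist o (e⁻¹ • o)]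
    (Fin.forall_fin_two.2 ⟨hβ₀.1, hβ₁.1⟩) (Fin.forall_fin_two.2 ⟨hβ₀.2.2, hβ₁.2.2⟩)
  have main : ∀ (f : G) (β : ℝ → X), HasMorseGeodesics o M f → IsGeodesicBetween β o (f • o) →
      (∀ h ∈ H, ∀ α : ℝ → X, IsGeodesicBetween α o (h • o) → ∀ s t, 0 ≤ s →
          s ≤ dist o (h • o) → 0 ≤ t → t ≤ dist o (f • o) →
            s + t ≤ 3 * dist (α s) (a • β t) + 21 * A) → ∀ h ∈ H, ∀ L : ℝ,
      DivergeUpTo o L 3 (22 * A + 4 * B) h (a * f * a⁻¹) := by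
    intro f β hMf hβ hdiv h hh L α ζ hα hζ s t hs hs' _ ht ht' _
    obtain ⟨v, hv, hd⟩ := hζ.2.2.exists_near hgeo ((hMf β hβ).smul a) dist_nonneg le_rfl
      dist_nonneg le_rfl (B := A) (by rwa [hζ.1, hβ.1])
      (by rwa [hζ.2.1, hβ.2.1, dist_conj_smul]) ht ht'
    have hd' : dist (ζ t) (a • β v) ≤ B := hd.trans (le_max_left _ _)
    have h1 := hdiv h hh α hα s v hs hs' hv.1 hv.2
    have h2 := hζ.2.2.dist_eq le_rfl ht ht'
    have h3 := hβ.2.2.dist_eq le_rfl hv.1 hv.2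
    rw [hζ.1] at h2
    rw [hβ.1, ← dist_smul a] at h3
    have h4 := dist_triangle4 o (a • o) (a • β v) (ζ t)
    have h5 := dist_triangle (α s) (ζ t) (a • β v)
    rw [dist_comm (a • β v)] at h4
    linarith
  refine ⟨a, ha, fun h hh L => ⟨main e β₀ hMe hβ₀ (hdiv 0) h hh L, ?_⟩⟩
  rw [conj_inv]
  exact main e⁻¹ β₁ hMe.inv hβ₁ (hdiv 1) h hh L

end Transversality

section Growth

variable {X G : Type*} [MetricSpace X] [Group G] [MulAction G X]

lemma ProperAction.finite_inter_ball (hproper : ProperAction G X) (o : X) (S : Set G) (r : ℝ) :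
    (S ∩ {g : G | dist o (g • o) ≤ r}).Finite :=
  (hproper o (max r 1) (by positivity)).subset fun _ hg => by
    simp only [mem_inter_iff, mem_ofPred_eq] at hg ⊢
    exact le_max_of_le_left hg.2

variable [IsIsometricSMul G X]

lemma ProperAction.exists_ncard_inter_ball_le (hproper : ProperAction G X) (o : X) {S S' : Set G}
    {k : ℕ} (hdense : ∀ h ∈ S, ∃ h' ∈ S', dist (h • o) (h' • o) ≤ k) :
    ∃ K : ℕ, K ≠ 0 ∧ ∀ n : ℕ, (S ∩ {g : G | dist o (g • o) ≤ (n : ℝ)}).ncard ≤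
      (S' ∩ {g : G | dist o (g • o) ≤ ((n + k : ℕ) : ℝ)}).ncard * K := by
  have hfin := hproper.finite_inter_ball o univ k
  refine ⟨_, Set.ncard_ne_zero_of_mem (a := 1) (by simp) hfin, fun n => ?_⟩
  rw [← Set.ncard_prod]
  choose! f hf hd using hdense
  refine Set.ncard_le_ncard_of_injOn (fun h => (f h, (f h)⁻¹ * h)) ?_ ?_
    ((hproper.finite_inter_ball o S' _).prod hfin)
  · rintro h ⟨hh, hn⟩
    have h1 := dist_triangle_right o (f h • o) (h • o)
    have h2 := hd h hh
    rw [mem_ofPred_eq] at hn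
    refine ⟨⟨hf h hh, ?_⟩, trivial, ?_⟩
    · rw [mem_ofPred_eq]
      push_cast
      rw [dist_comm (f h • o)] at h1
      linarith
    · rw [mem_ofPred_eq, mul_smul, ← dist_smul (f h), smul_inv_smul, dist_comm]
      exact h2
  · intro h _ h' _ e
    rw [Prod.mk.injEq] at e
    have e2 := e.2
    rwa [e.1, mul_left_cancel_iff] at e2

/-- A coarsely dense subset has the same growth rate. -/
lemma growthRate_eq_of_dense (hproper : ProperAction G X) (o : X) {S S' : Set G} (hsub : S' ⊆ S)
    {C : ℝ} (hdense : ∀ h ∈ S, ∃ h' ∈ S', dist (h • o) (h' • o) ≤ C) :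
    growthRate o S' = growthRate o S := by
  obtain ⟨k, hk⟩ := exists_nat_ge C
  obtain ⟨K, hK0, hK⟩ := hproper.exists_ncard_inter_ball_le o (k := k) fun h hh => by
    obtain ⟨h', hh', hd⟩ := hdense h hh
    exact ⟨h', hh', hd.trans hk⟩
  have hfin := fun n : ℕ => hproper.finite_inter_ball o S n
  unfold growthRate
  set a : ℕ → ℕ := fun n => (S ∩ {g : G | dist o (g • o) ≤ (n : ℝ)}).ncard
  set b : ℕ → ℕ := fun n => (S' ∩ {g : G | dist o (g • o) ≤ (n : ℝ)}).ncard
  have hba : ∀ n, b n ≤ a n := fun n =>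
    Set.ncard_le_ncard (inter_subset_inter_left _ hsub) (hfin n)
  have hlog : ∀ n, Real.log (b n) ≤ Real.log (a n) := by
    intro n
    rcases Nat.eq_zero_or_pos (b n) with h | h
    · rw [h, Nat.cast_zero, Real.log_zero]
      exact Real.log_natCast_nonneg _
    · exact Real.log_le_log (by exact_mod_cast h) (by exact_mod_cast hba n)
  have hlog' : ∀ n, Real.log (a n) ≤ Real.log (b (n + k)) + Real.log K := by
    intro n
    rcases Nat.eq_zero_or_pos (a n) with h | h
    · rw [h, Nat.cast_zero, Real.log_zero]
      exact add_nonneg (Real.log_natCast_nonneg _) (Real.log_natCast_nonneg _)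
    · have h1 : 0 < b (n + k) * K := h.trans_le (hK n)
      have h2 : b (n + k) ≠ 0 := by
        rintro h2
        simp [h2] at h1
      rw [← Real.log_mul (by exact_mod_cast h2) (by exact_mod_cast hK0)]
      exact Real.log_le_log (by exact_mod_cast h) (by exact_mod_cast hK n)
  have hbdd : ∀ d : ℕ → ℕ, BddBelow {x : ℝ | ∀ᶠ n : ℕ in atTop, Real.log (d n) / n ≤ x} := by
    intro d
    refine ⟨0, fun x hx => ?_⟩
    obtain ⟨n, hn⟩ := Eventually.exists hx
    exact (div_nonneg (Real.log_natCast_nonneg _) (Nat.cast_nonneg n)).trans hn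
  change limsup (fun n : ℕ => Real.log (b n) / n) atTop =
    limsup (fun n : ℕ => Real.log (a n) / n) atTop
  rw [limsup_eq, limsup_eq]
  have hmem : ∀ x : ℝ, (∀ᶠ n : ℕ in atTop, Real.log (b n) / n ≤ x) → ∀ ε > 0,
      ∀ᶠ n : ℕ in atTop, Real.log (a n) / n ≤ x + ε := by
    intro x hx ε hε
    have hlim : Tendsto (fun n : ℕ => (x * k + Real.log K) / n) atTop (nhds 0) :=
      tendsto_const_div_atTop_nhds_zero_nat _
    filter_upwards [(tendsto_add_atTop_nat k).eventually hx, hlim.eventually_le_const hε,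
      eventually_gt_atTop 0] with n h1 h2 hn
    have hn' : (0 : ℝ) < n := by exact_mod_cast hn
    rw [div_le_iff₀ (by positivity)] at h1 h2 ⊢
    push_cast at h1
    linarith [hlog' n]
  rcases eq_empty_or_nonempty {x : ℝ | ∀ᶠ n : ℕ in atTop, Real.log (b n) / n ≤ x} with h | h
  · rw [h, eq_comm]
    congr 1
    refine eq_empty_of_forall_notMem fun x hx => eq_empty_iff_forall_notMem.1 h x ?_
    filter_upwards [hx] with n hn
    exact (div_le_div_of_nonneg_right (hlog n) (Nat.cast_nonneg n)).trans hn
  · refine le_antisymm (csInf_le_csInf (hbdd b) ?_ ?_) (le_csInf h fun x hx => ?_)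
    · obtain ⟨x, hx⟩ := h
      exact ⟨x + 1, hmem x hx 1 one_pos⟩
    · intro x hx
      filter_upwards [hx] with n hn
      exact (div_le_div_of_nonneg_right (hlog n) (Nat.cast_nonneg n)).trans hn
    · exact le_of_forall_pos_le_add fun ε hε => csInf_le (hbdd a) (hmem x hx ε hε)

end Growth

section AlternatingWords

variable {G : Type*} [Group G]

/-- One of `a`, `b` lies in `Q` and the other one is `g` or `g⁻¹`. -/
def Alternates (Q : Set G) (g a b : G) : Prop :=
  (a ∈ Q ∧ (b = g ∨ b = g⁻¹)) ∨ ((a = g ∨ a = g⁻¹) ∧ b ∈ Q)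

lemma Alternates.inv {Q : Set G} (hQ : ∀ x ∈ Q, x⁻¹ ∈ Q) {g a b : G} (h : Alternates Q g a b) :
    Alternates Q g b⁻¹ a⁻¹ := by
  rcases h with ⟨ha, rfl | rfl⟩ | ⟨rfl | rfl, hb⟩ <;> simp_all [Alternates]

/-- The list of letters of a formal alternating word. -/
def flatWord (w : List (G × G)) : List G := w.flatMap fun p => [p.1, p.2]

lemma prod_flatWord (w : List (G × G)) : (flatWord w).prod = evalWord w := by
  induction w with
  | nil => rfl
  | cons p w ih =>
    simp only [flatWord, evalWord, List.flatMap_cons, List.prod_append, List.map_cons,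
      List.prod_cons, List.prod_nil, mul_one] at ih ⊢
    rw [ih]

lemma isChain_cons_flatWord {S Q : Set G} (hSQ : S ⊆ Q) {g : G} {w : List (G × G)}
    (hw : ∀ p ∈ w, p.1 ∈ S ∧ p.2 ∈ ({g} : Set G)) :
    (g :: flatWord w).IsChain (Alternates Q g) ∧
      ∀ x ∈ g :: flatWord w, x ∈ Q ∨ x = g ∨ x = g⁻¹ := by
  induction w with
  | nil => simp [flatWord]
  | cons p w ih =>
    obtain ⟨h1, h2⟩ := ih fun q hq => hw q (List.mem_cons_of_mem p hq)
    obtain ⟨hp1, hp2⟩ := hw p List.mem_cons_self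
    obtain ⟨x, y⟩ := p
    obtain rfl : y = g := hp2
    have hx : x ∈ Q := hSQ hp1
    have e : flatWord ((x, y) :: w) = x :: y :: flatWord w := rfl
    rw [e, List.isChain_cons_cons, List.isChain_cons_cons]
    exact ⟨⟨Or.inr ⟨Or.inl rfl, hx⟩, Or.inl ⟨hx, Or.inl rfl⟩, h1⟩, by simpa [hx] using h2⟩

/-- Evaluation of alternating words is injective as soon as non-empty alternating products of
elements of a sufficiently large set with `g` or `g⁻¹` are non-trivial. -/
lemma injOn_evalWord {S Q : Set G} (hSQ : S ⊆ Q) (hQ : ∀ x ∈ Q, x⁻¹ ∈ Q)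
    (hS : ∀ a ∈ S, ∀ b ∈ S, a ≠ b → a⁻¹ * b ∈ Q) {g : G}
    (hprod : ∀ l : List G, l ≠ [] → (∀ x ∈ l, x ∈ Q ∨ x = g ∨ x = g⁻¹) →
      l.IsChain (Alternates Q g) → l.prod ≠ 1) :
    Set.InjOn evalWord (AltWords S {g}) := by
  have hone : ∀ p (w : List (G × G)), (∀ q ∈ p :: w, q.1 ∈ S ∧ q.2 ∈ ({g} : Set G)) →
      evalWord (p :: w) ≠ 1 := by
    intro p w hw
    obtain ⟨h1, h2⟩ := isChain_cons_flatWord hSQ hw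
    rw [← prod_flatWord]
    exact hprod _ (by simp [flatWord]) (fun x hx => h2 x (List.mem_cons_of_mem g hx)) h1.tail
  suffices H : ∀ w w' : List (G × G), (∀ q ∈ w, q.1 ∈ S ∧ q.2 ∈ ({g} : Set G)) →
      (∀ q ∈ w', q.1 ∈ S ∧ q.2 ∈ ({g} : Set G)) → evalWord w = evalWord w' → w = w' from
    fun w hw w' hw' h => H w w' hw.2 hw'.2 h
  intro w
  induction w with
  | nil =>
    rintro (_ | ⟨q, w'⟩) _ hw' h
    · rfl
    · exact absurd h.symm (hone q w' hw')
  | cons p w ih =>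
    rintro (_ | ⟨q, w'⟩) hw hw' h
    · exact absurd h (hone p w hw)
    obtain ⟨hp1, hp2⟩ := hw p List.mem_cons_self
    obtain ⟨hq1, hq2⟩ := hw' q List.mem_cons_self
    replace hw : ∀ q ∈ w, q.1 ∈ S ∧ q.2 ∈ ({g} : Set G) :=
      fun q hq => hw q (List.mem_cons_of_mem _ hq)
    replace hw' : ∀ q ∈ w', q.1 ∈ S ∧ q.2 ∈ ({g} : Set G) :=
      fun q hq => hw' q (List.mem_cons_of_mem _ hq)
    obtain ⟨x, y⟩ := p
    obtain ⟨z, t⟩ := q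
    obtain rfl : y = g := hp2
    obtain rfl : t = y := hq2
    have h' : x * t * evalWord w = z * t * evalWord w' := h
    rcases eq_or_ne x z with rfl | hne
    · rw [ih w' hw hw' (mul_left_cancel h')]
    · exfalso
      obtain ⟨hc, hm⟩ := isChain_cons_flatWord hSQ hw
      obtain ⟨hc', hm'⟩ := isChain_cons_flatWord hSQ hw'
      have hxz := hS x hp1 z hq1 hne
      refine hprod (((t :: flatWord w).map (·⁻¹)).reverse ++ (x⁻¹ * z) :: (t :: flatWord w'))
        (by simp) ?_ ?_ ?_
      · intro u hu
        simp only [List.mem_append, List.mem_reverse, List.mem_map, List.mem_cons (a := u)] at hu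
        rcases hu with ⟨v, hv, rfl⟩ | rfl | hu
        · rcases hm v hv with h | rfl | rfl
          · exact Or.inl (hQ v h)
          · simp
          · simp
        · exact Or.inl hxz
        · exact hm' u (List.mem_cons.2 hu)
      · have hrev : ((t :: flatWord w).map (·⁻¹)).reverse.IsChain (Alternates Q t) := by
          rw [List.isChain_reverse, List.isChain_map]
          exact hc.imp fun a b hab => hab.inv hQ
        rw [List.map_cons, List.reverse_cons] at hrev ⊢
        rw [List.append_assoc, List.singleton_append, List.isChain_append_cons_cons,
          List.isChain_cons_cons]
        exact ⟨hrev, Or.inr ⟨Or.inr rfl, hxz⟩, Or.inl ⟨hxz, Or.inl rfl⟩, hc'⟩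
      · rw [List.prod_append, ← List.prod_inv_reverse, List.prod_cons, List.prod_cons,
          List.prod_cons, prod_flatWord, prod_flatWord]
        calc (t * evalWord w)⁻¹ * (x⁻¹ * z * (t * evalWord w'))
            = (x * t * evalWord w)⁻¹ * (z * t * evalWord w') := by group
          _ = 1 := by rw [h', inv_mul_cancel]

end AlternatingWords

section FreeProduct

variable {X G : Type*} [MetricSpace X] [Group G] [MulAction G X]

lemma DivergeUpTo.mono {o : X} {L L' lam c : ℝ} {a b : G} (h : DivergeUpTo o L lam c a b)
    (hL : L' ≤ L) : DivergeUpTo o L' lam c a b :=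
  fun α β hα hβ s t hs hs' hsL ht ht' htL =>
    h α β hα hβ s t hs hs' (hsL.trans hL) ht ht' (htL.trans hL)

/-- Every set of group elements has a coarsely dense subset with separated orbit. -/
lemma exists_separated_subset (o : X) (S : Set G) {R : ℝ} (hR : 0 ≤ R) :
    ∃ S' ⊆ S, (∀ a ∈ S', ∀ b ∈ S', a ≠ b → R < dist (a • o) (b • o)) ∧
      ∀ h ∈ S, ∃ h' ∈ S', dist (h • o) (h' • o) ≤ R := by
  obtain ⟨S', hmax⟩ := zorn_subset
    {T : Set G | T ⊆ S ∧ T.Pairwise fun a b => R < dist (a • o) (b • o)} fun c hc hchain =>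
      ⟨⋃₀ c, ⟨sUnion_subset fun T hT => (hc hT).1,
        (Set.pairwise_sUnion hchain.directedOn).2 fun T hT => (hc hT).2⟩,
        fun T hT => subset_sUnion_of_mem hT⟩
  refine ⟨S', hmax.prop.1, fun a ha b hb hab => hmax.prop.2 ha hb hab, fun h hh => ?_⟩
  by_contra! hfar
  have hmem : insert h S' ∈
      {T : Set G | T ⊆ S ∧ T.Pairwise fun a b => R < dist (a • o) (b • o)} := by
    refine ⟨insert_subset hh hmax.prop.1, hmax.prop.2.insert fun b hb _ => ⟨hfar b hb, ?_⟩⟩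
    rw [dist_comm]
    exact hfar b hb
  have h1 := hfar h (hmax.le_of_ge hmem (subset_insert h S') (mem_insert h S'))
  rw [dist_self] at h1
  linarith

variable [IsIsometricSMul G X]

lemma dist_inv_mul_smul (o : X) (a b : G) : dist o ((a⁻¹ * b) • o) = dist (a • o) (b • o) := by
  rw [mul_smul, ← dist_smul a, smul_inv_smul]

lemma exists_isMorseElement (hproper : ProperAction G X) (hcocompact : CocompactAction G X)
    (hgeo : GeodesicSpace X) (hmltg : MorseLocalToGlobalSpace X) (o : X)
    (hray : ∃ (γ : ℝ → X) (M : ℝ → ℝ → ℝ), IsMorseGeodesicRay γ M) :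
    ∃ M : ℝ → ℝ → ℝ, ∀ L : ℝ, ∃ e : G, IsMorseElement o e ∧ L ≤ dist o (e • o) ∧
      HasMorseGeodesics o M e := by
  obtain ⟨γ, M₀, hγ⟩ := hray
  obtain ⟨M, c, hc, hM⟩ := exists_divergeUpTo_inv_self hproper hcocompact hgeo o hγ
  obtain ⟨L₀, hL₀⟩ := exists_isMorseElement_of_divergeUpTo (G := G) hgeo hmltg o M hc
  refine ⟨M, fun L => ?_⟩
  obtain ⟨e, he, hMe, hde⟩ := hM (max L L₀)
  exact ⟨e, hL₀ e ((le_max_right _ _).trans he) hMe (hde.mono (le_max_right _ _)),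
    (le_max_left _ _).trans he, hMe⟩

/-- For an infinite-index stable subgroup `H`, some Morse element generates alternating words with
the long elements of `H` that are all non-trivial. -/
lemma exists_isMorseElement_prod_ne_one (hproper : ProperAction G X)
    (hcocompact : CocompactAction G X) (hgeo : GeodesicSpace X) (hmltg : MorseLocalToGlobalSpace X)
    {o : X} (hray : ∃ (γ : ℝ → X) (M : ℝ → ℝ → ℝ), IsMorseGeodesicRay γ M) {H : Subgroup G}
    (hstable : IsStableSubgroup o H) (hindex : H.index = 0) :
    ∃ (g : G) (R : ℝ), IsMorseElement o g ∧ 0 ≤ R ∧ ∀ l : List G, l ≠ [] →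
      (∀ x ∈ l, x ∈ {h : G | h ∈ H ∧ R < dist o (h • o)} ∨ x = g ∨ x = g⁻¹) →
      l.IsChain (Alternates {h : G | h ∈ H ∧ R < dist o (h • o)} g) → l.prod ≠ 1 := by
  obtain ⟨M₁, hM₁⟩ := exists_isMorseElement (G := G) hproper hcocompact hgeo hmltg o hray
  obtain ⟨A, c, hc, hA⟩ := exists_conj_divergeUpTo hproper hgeo hstable hindex M₁
  obtain ⟨M₂, hM₂⟩ := exists_hasMorseGeodesics_conj (G := G) hgeo o M₁ A
  obtain ⟨M₃, D, -, hM₃⟩ := hstable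
  choose γ hγ using fun a : G => hgeo o (a • o)
  replace hγ : ∀ a, IsGeodesicBetween (γ a) o (a • o) := hγ
  obtain ⟨_, L, _, _, -, hL⟩ := exists_wordPath_isMorseOn hgeo hmltg hγ
    (fun lam c => max (M₂ lam c) (M₃ lam c)) (lam := 3) (by norm_num) hc
  obtain ⟨e, hMorse, hLe, hMe⟩ := hM₁ (L + 2 * A)
  obtain ⟨a, ha, hdiv⟩ := hA e hMe
  refine ⟨a * e * a⁻¹, max L 0, hMorse.conj hgeo a, le_max_right _ _, fun l hne hl hchain => ?_⟩
  have hMg := hM₂ a e ha hMe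
  have hLg : L ≤ dist o ((a * e * a⁻¹) • o) := by
    have h1 := dist_triangle4 (a • o) o ((a * e * a⁻¹) • o) (a • e • o)
    rw [dist_conj_smul, dist_smul, dist_comm (a • o)] at h1
    linarith
  generalize a * e * a⁻¹ = g at *
  refine (hL l hne (fun x hx => ?_) (hchain.imp ?_)).2.2
  · rcases hl x hx with ⟨hxH, hxR⟩ | rfl | rfl
    · refine ⟨(le_max_left _ _).trans hxR.le, fun ζ hζ => ?_⟩
      exact (hM₃ x hxH ζ hζ.1 hζ.2.1 hζ.2.2).1.mono fun _ _ => le_max_right _ _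
    · exact ⟨hLg, hMg.mono fun _ _ => le_max_left _ _⟩
    · exact ⟨hLg.trans (dist_inv_smul o g).ge, hMg.inv.mono fun _ _ => le_max_left _ _⟩
  · rintro x y (⟨⟨hx, -⟩, rfl | rfl⟩ | ⟨rfl | rfl, ⟨hy, -⟩⟩)
    · exact (hdiv x⁻¹ (inv_mem hx) L).1
    · exact (hdiv x⁻¹ (inv_mem hx) L).2
    · exact (hdiv y hy L).2.symm
    · rw [inv_inv]
      exact (hdiv y hy L).1.symm

lemma injOn_evalWord_singleton_one {g : G} (hg : ¬ IsOfFinOrder g) :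
    Set.InjOn evalWord (AltWords {1} {g}) := by
  have key : ∀ w ∈ AltWords {1} {g}, w = List.replicate w.length (1, g) ∧
      evalWord w = g ^ w.length := by
    intro w hw
    have h1 : w = List.replicate w.length (1, g) :=
      List.eq_replicate_of_mem fun p hp => Prod.ext (hw.2 p hp).1 (hw.2 p hp).2
    refine ⟨h1, ?_⟩
    rw [h1]
    simp [evalWord]
  intro w hw w' hw' h
  rw [(key w hw).2, (key w' hw').2] at h
  rw [(key w hw).1, (key w' hw').1, injective_pow_iff_not_isOfFinOrder.2 hg h]

end FreeProduct

/-- Embedding a free product of sets: for an infinite-index stable subgroup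
`H` there exist a Morse element `g`, a constant `C ≥ 0` and a subset `H' ⊆ H` which is
`C`-dense in `H`, has the same growth rate as `H`, and for which the evaluation map on
alternating words `𝕎(H', {g})` is injective. -/
theorem embedding_free_product_of_subsets
    {X G : Type*} [MetricSpace X] [ProperSpace X] [Group G] [MulAction G X] (o : X)
    (hiso : IsometricAction G X) (hproper : ProperAction G X)
    (hcocompact : CocompactAction G X)
    (hgeo : GeodesicSpace X) (hmltg : MorseLocalToGlobalSpace X)
    (hray : ∃ (γ : ℝ → X) (M : ℝ → ℝ → ℝ), IsMorseGeodesicRay γ M)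
    (hnonelem : ¬ VirtuallyCyclic G)
    (H : Subgroup G) (hstable : IsStableSubgroup o H) (hinf : H.index = 0) :
    ∃ (g : G) (C : ℝ) (H' : Set G), IsMorseElement o g ∧ 0 ≤ C ∧ H' ⊆ (H : Set G) ∧
      (∀ h ∈ H, ∃ h' ∈ H', dist (h • o) (h' • o) ≤ C) ∧
      growthRate o H' = growthRate o (H : Set G) ∧
      Set.InjOn evalWord (AltWords H' {g}) := by
  have : IsIsometricSMul G X := ⟨fun g => Isometry.of_dist_eq (hiso g)⟩
  suffices h : ∃ (g : G) (C : ℝ) (H' : Set G), IsMorseElement o g ∧ 0 ≤ C ∧ H' ⊆ (H : Set G) ∧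
      (∀ h ∈ H, ∃ h' ∈ H', dist (h • o) (h' • o) ≤ C) ∧
      Set.InjOn evalWord (AltWords H' {g}) by
    obtain ⟨g, C, H', hg, hC, hsub, hdense, hinj⟩ := h
    exact ⟨g, C, H', hg, hC, hsub, hdense, growthRate_eq_of_dense hproper o hsub hdense, hinj⟩
  rcases (H : Set G).finite_or_infinite with hfin | hinfinite
  · obtain ⟨M, hM⟩ := exists_isMorseElement (G := G) hproper hcocompact hgeo hmltg o hray
    obtain ⟨g, hg, -⟩ := hM 0
    obtain ⟨C, hC⟩ := (hfin.image fun h => dist (h • o) o).bddAbove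
    refine ⟨g, max C 0, {1}, hg, le_max_right _ _, by simp, fun h hh => ⟨1, rfl, ?_⟩,
      injOn_evalWord_singleton_one hg.1⟩
    rw [one_smul]
    exact (hC (mem_image_of_mem _ hh)).trans (le_max_left _ _)
  · obtain ⟨g, R, hg, hR, hprod⟩ :=
      exists_isMorseElement_prod_ne_one hproper hcocompact hgeo hmltg hray hstable hinf
    obtain ⟨h₀, hh₀⟩ : ∃ h₀ ∈ H, R < dist o (h₀ • o) := by
      by_contra! h
      exact hinfinite ((hproper.finite_inter_ball o (H : Set G) R).subset fun x hx => ⟨hx, h x hx⟩)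
    obtain ⟨H', hsub, hsep, hdense⟩ :=
      exists_separated_subset o {h : G | h ∈ H ∧ R < dist o (h • o)} hR
    refine ⟨g, 2 * R + dist o (h₀ • o), H', hg, by positivity, fun h hh => (hsub hh).1,
      fun h hh => ?_, injOn_evalWord hsub ?_ ?_ hprod⟩
    · rcases lt_or_ge R (dist o (h • o)) with hlt | hle
      · obtain ⟨h', hh', hd⟩ := hdense h ⟨hh, hlt⟩
        exact ⟨h', hh', by linarith [dist_nonneg (x := o) (y := h₀ • o)]⟩
      · obtain ⟨h', hh', hd⟩ := hdense h₀ hh₀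
        refine ⟨h', hh', ?_⟩
        have := dist_triangle4 (h • o) o (h₀ • o) (h' • o)
        rw [dist_comm (h • o) o] at this
        linarith
    · rintro x ⟨hx, hxR⟩
      exact ⟨inv_mem hx, by rwa [dist_inv_smul]⟩
    · intro a ha b hb hab
      refine ⟨mul_mem (inv_mem (hsub ha).1) (hsub hb).1, ?_⟩
      rw [dist_inv_mul_smul]
      exact hsep a ha b hb hab
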